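/- Every hitomezashi loop has area congruent to 1 modulo 4. -/

import Mathlib

/-- A stitch is a unit segment of the grid: `vert i j` is the vertical segment from
`(i,j)` to `(i,j+1)`; `horiz i j` is the horizontal segment from `(i,j)` to `(i+1,j)`. -/
inductive Stitch : Type
  | vert : ℤ → ℤ → Stitch
  | horiz : ℤ → ℤ → Stitch
  deriving DecidableEq

/-- Membership of a stitch in the hitomezashi pattern with labels `ε` (vertical lines)
and `η` (horizontal lines). -/
def Stitch.InPattern (ε η : ℤ → ZMod 2) : Stitch → Prop
  | .vert i j => (j : ZMod 2) = ε i
  | .horiz i j => (i : ZMod 2) = η j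

/-- The stitch as a subset of the plane. -/
def Stitch.seg : Stitch → Set (ℝ × ℝ)
  | .vert i j => segment ℝ ((i : ℝ), (j : ℝ)) ((i : ℝ), (j : ℝ) + 1)
  | .horiz i j => segment ℝ ((i : ℝ), (j : ℝ)) ((i : ℝ) + 1, (j : ℝ))

/-- The union of the segments of a set of stitches. -/
def curveOf (S : Set Stitch) : Set (ℝ × ℝ) := ⋃ s ∈ S, s.seg

/-- `C` is a simple closed curve: it is homeomorphic to a circle. -/
def IsCircle (C : Set (ℝ × ℝ)) : Prop :=
  Nonempty (C ≃ₜ Metric.sphere (0 : ℝ × ℝ) 1)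

/-- The interior of a closed curve `C`: the union of the bounded connected
components of its complement. -/
def intOf (C : Set (ℝ × ℝ)) : Set (ℝ × ℝ) :=
  {p | p ∉ C ∧ Bornology.IsBounded (connectedComponentIn Cᶜ p)}

/-- The exterior of a closed curve `C`: the union of the unbounded connected
components of its complement. -/
def extOf (C : Set (ℝ × ℝ)) : Set (ℝ × ℝ) :=
  {p | p ∉ C ∧ ¬ Bornology.IsBounded (connectedComponentIn Cᶜ p)}

/-- The open unit cell with southwest corner `(i,j)`. -/
def cell (i j : ℤ) : Set (ℝ × ℝ) :=
  Set.Ioo (i : ℝ) ((i : ℝ) + 1) ×ˢ Set.Ioo (j : ℝ) ((j : ℝ) + 1)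

/-- A hitomezashi loop in the pattern with labels `ε`, `η`: a (finite) set of stitches
of the pattern whose union is a simple closed curve. -/
structure HLoop (ε η : ℤ → ZMod 2) where
  stitches : Finset Stitch
  inPattern : ∀ s ∈ stitches, s.InPattern ε η
  isCircle : IsCircle (curveOf ↑stitches)

/-- The lattice walk that moves along its row with velocity `a` at vertices of one parity and
along its column with velocity `b` at vertices of the other parity. -/
def latticeStep (κ : ℤ) (a b : ℤ → ℤ) (v : ℤ × ℤ) : ℤ × ℤ :=
  if Even (v.1 + v.2 + κ) then (v.1 + a v.2, v.2) else (v.1, v.2 + b v.1)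

section LatticeStep

variable {κ : ℤ} {a b : ℤ → ℤ}

lemma latticeStep_of_even {i j : ℤ} (h : Even (i + j + κ)) :
    latticeStep κ a b (i, j) = (i + a j, j) := if_pos h

lemma latticeStep_of_odd {i j : ℤ} (h : ¬ Even (i + j + κ)) :
    latticeStep κ a b (i, j) = (i, j + b i) := if_neg h

/-- The inverse of `latticeStep`. -/
def latticeStepBack (κ : ℤ) (a b : ℤ → ℤ) (v : ℤ × ℤ) : ℤ × ℤ :=
  if Even (v.1 + v.2 + κ) then (v.1, v.2 - b v.1) else (v.1 - a v.2, v.2)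

lemma even_add_unit {x e : ℤ} (he : e = 1 ∨ e = -1) : Even (x + e) ↔ ¬ Even x := by
  rcases he with rfl | rfl <;> grind

lemma even_latticeStep (ha : ∀ j, a j = 1 ∨ a j = -1) (hb : ∀ i, b i = 1 ∨ b i = -1)
    (v : ℤ × ℤ) : Even ((latticeStep κ a b v).1 + (latticeStep κ a b v).2 + κ) ↔
      ¬ Even (v.1 + v.2 + κ) := by
  unfold latticeStep
  split_ifs with h
  · have := even_add_unit (x := v.1 + v.2 + κ) (ha v.2)
    rw [← this]; ring_nf
  · have := even_add_unit (x := v.1 + v.2 + κ) (hb v.1)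
    rw [← this]; ring_nf

lemma latticeStepBack_latticeStep (ha : ∀ j, a j = 1 ∨ a j = -1) (hb : ∀ i, b i = 1 ∨ b i = -1)
    (v : ℤ × ℤ) : latticeStepBack κ a b (latticeStep κ a b v) = v := by
  have h := even_latticeStep (κ := κ) ha hb v
  unfold latticeStepBack
  by_cases hv : Even (v.1 + v.2 + κ)
  · rw [if_neg (by tauto)]; simp [latticeStep, hv]
  · rw [if_pos (by tauto)]; simp [latticeStep, hv]

lemma latticeStep_latticeStepBack (ha : ∀ j, a j = 1 ∨ a j = -1) (hb : ∀ i, b i = 1 ∨ b i = -1)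
    (v : ℤ × ℤ) : latticeStep κ a b (latticeStepBack κ a b v) = v := by
  unfold latticeStepBack
  split_ifs with hv
  · have h : ¬ Even (v.1 + (v.2 - b v.1) + κ) := by
      have := even_add_unit (x := v.1 + (v.2 - b v.1) + κ) (hb v.1)
      rw [← this]; convert hv using 1; ring
    rw [latticeStep_of_odd h]; simp
  · have h : Even (v.1 - a v.2 + v.2 + κ) := by
      have := even_add_unit (x := v.1 - a v.2 + v.2 + κ) (ha v.2)
      by_contra hc
      rw [← this] at hc; apply hv; convert hc using 1; ring
    rw [latticeStep_of_even h]; simp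

lemma latticeStep_injective (ha : ∀ j, a j = 1 ∨ a j = -1) (hb : ∀ i, b i = 1 ∨ b i = -1) :
    Function.Injective (latticeStep κ a b) :=
  Function.LeftInverse.injective (latticeStepBack_latticeStep ha hb)

/-- Reindexing a sum over a finite set mapped into itself by the walk. -/
lemma sum_comp_latticeStep {M : Type*} [AddCommMonoid M]
    (ha : ∀ j, a j = 1 ∨ a j = -1) (hb : ∀ i, b i = 1 ∨ b i = -1)
    {P : Finset (ℤ × ℤ)} (hP : ∀ v ∈ P, latticeStep κ a b v ∈ P) (f : ℤ × ℤ → M) :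
    ∑ v ∈ P, f (latticeStep κ a b v) = ∑ v ∈ P, f v := by
  have himg : P.image (latticeStep κ a b) = P :=
    Finset.eq_of_subset_of_card_le (Finset.image_subset_iff.2 hP)
      (Finset.card_image_of_injective _ (latticeStep_injective ha hb)).ge
  conv_rhs => rw [← himg]
  rw [Finset.sum_image fun _ _ _ _ h => latticeStep_injective ha hb h]

/-- The displacements of the walk sum to zero over a finite invariant set, so its cardinality is
four times the number of steps to the left. -/
lemma card_eq_of_mapsTo {α : ℤ → ℤ} (ha' : ∀ j, a j = 1 - 2 * α j)
    (ha : ∀ j, a j = 1 ∨ a j = -1) (hb : ∀ i, b i = 1 ∨ b i = -1)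
    {P : Finset (ℤ × ℤ)} (hP : ∀ v ∈ P, latticeStep κ a b v ∈ P) :
    (P.card : ℤ) = 4 * ∑ v ∈ P, if Even (v.1 + v.2 + κ) then α v.2 else 0 := by
  have h1 := sum_comp_latticeStep ha hb hP (fun v => v.1)
  have h2 := sum_comp_latticeStep ha hb hP
    (fun v => if Even (v.1 + v.2 + κ) then (1 : ℤ) else 0)
  simp only [even_latticeStep ha hb] at h2
  have h3 : ∀ v ∈ P, (latticeStep κ a b v).1 = v.1 + (if Even (v.1 + v.2 + κ) then (1 : ℤ) else 0)
      - 2 * (if Even (v.1 + v.2 + κ) then α v.2 else 0) := by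
    intro v _
    unfold latticeStep
    split_ifs
    · simp [ha']; ring
    · simp
  rw [Finset.sum_congr rfl h3, Finset.sum_sub_distrib, Finset.sum_add_distrib,
    ← Finset.mul_sum] at h1
  have h4 : (P.card : ℤ) = ∑ v ∈ P, (if ¬ Even (v.1 + v.2 + κ) then (1 : ℤ) else 0)
      + ∑ v ∈ P, (if Even (v.1 + v.2 + κ) then (1 : ℤ) else 0) := by
    rw [← Finset.sum_add_distrib, Finset.card_eq_sum_ones]
    push_cast
    refine Finset.sum_congr rfl fun v _ => ?_
    split_ifs <;> simp_all
  linarith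

lemma exists_partial_sum (α : ℤ → ℤ) : ∃ X : ℤ → ℤ, ∀ j, X (j + 1) = X j + α j := by
  refine ⟨fun j => ∑ k ∈ Finset.Ico 0 j, α k - ∑ k ∈ Finset.Ico j 0, α k, fun j => ?_⟩
  rcases le_or_gt 0 j with h | h
  · have h1 : Finset.Ico 0 (j + 1) = insert j (Finset.Ico 0 j) := by ext; simp; omega
    have h2 : Finset.Ico (j + 1) 0 = ∅ := by simp; omega
    have h3 : Finset.Ico j 0 = ∅ := by simp; omega
    simp only [h1, h2, h3]
    rw [Finset.sum_insert (by simp)]; simp; ring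
  · have h1 : Finset.Ico j 0 = insert j (Finset.Ico (j + 1) 0) := by ext; simp; omega
    have h2 : Finset.Ico 0 (j + 1) = ∅ := by simp; omega
    have h3 : Finset.Ico 0 j = ∅ := by simp; omega
    simp only [h1, h2, h3]
    rw [Finset.sum_insert (by simp)]; simp

/-- The sign `-1` or `1` of a vertex according to its parity class. -/
def paritySign (κ : ℤ) (v : ℤ × ℤ) : ℤ := if Even (v.1 + v.2 + κ) then -1 else 1

/-- Over a finite invariant set, the number of steps to the left agrees modulo two with the number
of corners at which both signs are negative, counted with the sign of the parity class. -/
lemma sum_left_eq {α β : ℤ → ℤ} (hb' : ∀ i, b i = 1 - 2 * β i)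
    (ha : ∀ j, a j = 1 ∨ a j = -1) (hb : ∀ i, b i = 1 ∨ b i = -1)
    {P : Finset (ℤ × ℤ)} (hP : ∀ v ∈ P, latticeStep κ a b v ∈ P) :
    ∑ v ∈ P, (if Even (v.1 + v.2 + κ) then α v.2 else 0) =
      ∑ v ∈ P, paritySign κ v * (α v.2 * β v.1) +
        2 * ∑ v ∈ P, (if Even (v.1 + v.2 + κ) then α v.2 * β v.1 else 0) := by
  obtain ⟨X, hX⟩ := exists_partial_sum α
  have h1 := sum_comp_latticeStep ha hb hP (fun v => X v.2)
  have h2 := sum_comp_latticeStep ha hb hP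
    (fun v => if Even (v.1 + v.2 + κ) then 0 else α v.2)
  have h3 := sum_comp_latticeStep ha hb hP
    (fun v => if Even (v.1 + v.2 + κ) then α v.2 * β v.1 else 0)
  simp only [even_latticeStep ha hb] at h2 h3
  have key : ∀ v ∈ P, X (latticeStep κ a b v).2 = X v.2 + (if Even (v.1 + v.2 + κ) then 0 else α v.2)
      - (if Even (v.1 + v.2 + κ) then 0 else α v.2 * β v.1)
      - (if ¬ Even (v.1 + v.2 + κ) then
        α (latticeStep κ a b v).2 * β (latticeStep κ a b v).1 else 0) := by
    intro v _
    unfold latticeStep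
    split_ifs with h
    · simp
    · rcases hb v.1 with hb1 | hb1
      · have : β v.1 = 0 := by linarith [hb' v.1]
        simp [hb1, hX, this]
      · have : β v.1 = 1 := by linarith [hb' v.1]
        have h5 := hX (v.2 - 1)
        simp only [sub_add_cancel] at h5
        simp only [hb1, this, ← sub_eq_add_neg]
        linarith
  rw [Finset.sum_congr rfl key, Finset.sum_sub_distrib, Finset.sum_sub_distrib,
    Finset.sum_add_distrib, h3] at h1
  have h4 : ∑ v ∈ P, (if ¬ Even (v.1 + v.2 + κ) then 0 else α (latticeStep κ a b v).2)
      = ∑ v ∈ P, (if Even (v.1 + v.2 + κ) then α v.2 else 0) := by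
    refine Finset.sum_congr rfl fun v _ => ?_
    by_cases h : Even (v.1 + v.2 + κ) <;> simp [latticeStep, h]
  rw [h4] at h2
  have h5 : ∑ v ∈ P, paritySign κ v * (α v.2 * β v.1) =
      ∑ v ∈ P, (if Even (v.1 + v.2 + κ) then 0 else α v.2 * β v.1) -
      ∑ v ∈ P, (if Even (v.1 + v.2 + κ) then α v.2 * β v.1 else 0) := by
    rw [← Finset.sum_sub_distrib]
    refine Finset.sum_congr rfl fun v _ => ?_
    unfold paritySign
    split_ifs <;> ring
  linarith

end LatticeStep

/-- The signed number of crossings of the ray `{(x, 1/2) | x > 0}` by the unit step from `d`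
to `d'`. -/
def rayCrossing (d d' : ℤ × ℤ) : ℤ :=
  if 1 ≤ d.1 ∧ d'.1 = d.1 then
    (if d.2 = 0 ∧ d'.2 = 1 then 1 else if d.2 = 1 ∧ d'.2 = 0 then -1 else 0) else 0

/-- The four unit steps of the square lattice. -/
def IsUnitStep (e : ℤ × ℤ) : Prop :=
  e = (1, 0) ∨ e = (-1, 0) ∨ e = (0, 1) ∨ e = (0, -1)

lemma rayCrossing_square {d e f : ℤ × ℤ} (he : IsUnitStep e) (hf : IsUnitStep f)
    (h1 : d ≠ 0) (h2 : d + f ≠ 0) (h3 : d - e ≠ 0) (h4 : d + f - e ≠ 0) :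
    rayCrossing d (d + f) + rayCrossing (d + f) (d + f - e) =
      rayCrossing d (d - e) + rayCrossing (d - e) (d + f - e) := by
  obtain ⟨x, y⟩ := d
  unfold rayCrossing
  rcases he with rfl | rfl | rfl | rfl <;> rcases hf with rfl | rfl | rfl | rfl <;>
    simp only [Prod.mk_add_mk, Prod.mk_sub_mk, ne_eq, Prod.mk_eq_zero] at * <;> grind

lemma rayCrossing_eq_zero_of_fst_nonpos {d d' : ℤ × ℤ} (h : d.1 ≤ 0) : rayCrossing d d' = 0 := by
  unfold rayCrossing; grind

lemma rayCrossing_eq_zero_of_snd_nonpos {d d' : ℤ × ℤ} (h : d.2 ≤ 0) (h' : d'.2 ≤ 0) :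
    rayCrossing d d' = 0 := by
  unfold rayCrossing; grind

lemma rayCrossing_eq_sub_of_upper {d f : ℤ × ℤ} (hf : IsUnitStep f)
    (h : 0 < d.2 ∨ 0 = d.2 ∧ 0 < d.1) (h' : 0 < (d + f).2 ∨ 0 = (d + f).2 ∧ 0 < (d + f).1) :
    rayCrossing d (d + f) = (if 0 < (d + f).2 then 1 else 0) - (if 0 < d.2 then 1 else 0) := by
  obtain ⟨x, y⟩ := d
  unfold rayCrossing
  rcases hf with rfl | rfl | rfl | rfl <;> simp only [Prod.mk_add_mk] at * <;> grind

/-- The crossing number of the path `p (s+1) - p s`, `p (s+2) - p s`, `p (s+2) - p (s+1)`. -/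
def cornerCrossing (p : ℕ → ℤ × ℤ) (s : ℕ) : ℤ :=
  rayCrossing (p (s + 1) - p s) (p (s + 2) - p s) +
    rayCrossing (p (s + 2) - p s) (p (s + 2) - p (s + 1))

lemma sum_secant_crossing {p : ℕ → ℤ × ℤ} (hp : ∀ k, IsUnitStep (p (k + 1) - p k)) {s m : ℕ}
    (hm : s + 2 ≤ m) (hne : ∀ t, s + 1 ≤ t → t ≤ m → p s ≠ p t)
    (hne' : ∀ t, s + 2 ≤ t → t ≤ m → p (s + 1) ≠ p t) :
    ∑ t ∈ Finset.Ico (s + 1) m, rayCrossing (p t - p s) (p (t + 1) - p s) +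
        rayCrossing (p m - p s) (p m - p (s + 1)) =
      cornerCrossing p s +
        ∑ t ∈ Finset.Ico (s + 2) m, rayCrossing (p t - p (s + 1)) (p (t + 1) - p (s + 1)) := by
  induction m, hm using Nat.le_induction with
  | base => simp [cornerCrossing]
  | succ m hm ih =>
    have ih := ih (fun t h h' => hne t h (by omega)) (fun t h h' => hne' t h (by omega))
    rw [Finset.sum_Ico_succ_top (by omega), Finset.sum_Ico_succ_top (by omega)]
    have h1 := sub_ne_zero.2 (hne m (by omega) (by omega)).symm
    have h2 := sub_ne_zero.2 (hne (m + 1) (by omega) (by omega)).symm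
    have h3 := sub_ne_zero.2 (hne' m (by omega) (by omega)).symm
    have h4 := sub_ne_zero.2 (hne' (m + 1) (by omega) (by omega)).symm
    have key := rayCrossing_square (d := p m - p s) (hp s) (hp m) h1
      (by convert h2 using 1; abel) (by convert h3 using 1; abel) (by convert h4 using 1; abel)
    have e1 : p m - p s + (p (m + 1) - p m) = p (m + 1) - p s := by abel
    have e2 : p m - p s - (p (s + 1) - p s) = p m - p (s + 1) := by abel
    have e3 : p (m + 1) - p s - (p (s + 1) - p s) = p (m + 1) - p (s + 1) := by abel
    rw [e1, e2, e3] at key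
    linarith

/-- Discrete Umlaufsatz: a simple closed lattice path which starts at its lowest leftmost vertex,
leaves it to the right and returns to it from above has rotation number one. -/
theorem sum_cornerCrossing {p : ℕ → ℤ × ℤ} (hp : ∀ k, IsUnitStep (p (k + 1) - p k)) {n : ℕ}
    (hclosed : p (n + 3) = p 0)
    (hne : ∀ s t, s < t → t < n + 3 → p s ≠ p t)
    (hmin : ∀ k, (p 0).2 < (p k).2 ∨ (p 0).2 = (p k).2 ∧ (p 0).1 ≤ (p k).1)
    (hfirst : p 1 = p 0 + (1, 0)) (hlast : p (n + 2) = p 0 + (0, 1)) :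
    ∑ s ∈ Finset.range (n + 2), cornerCrossing p s = 1 := by
  have hne' : ∀ s t, 1 ≤ s → s < t → t ≤ n + 3 → p s ≠ p t := by
    intro s t hs hst ht
    rcases ht.lt_or_eq with h | rfl
    · exact hne s t hst h
    · rw [hclosed]; exact (hne 0 s hs hst).symm
  set R : ℕ → ℤ := fun s =>
    ∑ t ∈ Finset.Ico (s + 1) (n + 3), rayCrossing (p t - p s) (p (t + 1) - p s) with hR
  have hrow : ∀ s, 1 ≤ s → s ≤ n + 1 → R s = cornerCrossing p s + R (s + 1) := by
    intro s hs hsn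
    have := sum_secant_crossing hp (s := s) (m := n + 3) (by omega)
      (fun t h h' => hne' s t hs (by omega) h') (fun t h h' => hne' (s + 1) t (by omega) (by omega) h')
    rw [hclosed, rayCrossing_eq_zero_of_snd_nonpos] at this
    · simpa [hR] using this
    · have := hmin s; simp only [Prod.snd_sub]; omega
    · have := hmin (s + 1); simp only [Prod.snd_sub]; omega
  have hsum : ∀ k, k ≤ n + 1 →
      R 1 = ∑ s ∈ Finset.range k, cornerCrossing p (s + 1) + R (k + 1) := by
    intro k
    induction k with
    | zero => simp
    | succ k ih =>
      intro hk
      rw [ih (by omega), hrow (k + 1) (by omega) (by omega), Finset.sum_range_succ]; ring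
  have hR1 := hsum (n + 1) le_rfl
  have hlastR : R (n + 1 + 1) = 0 := by simp [hR]
  have h0 := sum_secant_crossing hp (s := 0) (m := n + 2) (by omega)
    (fun t h h' => hne 0 t (by omega) (by omega)) (fun t h h' => hne 1 t (by omega) (by omega))
  have hupper : ∀ t, 1 ≤ t → t ≤ n + 2 →
      0 < (p t - p 0).2 ∨ 0 = (p t - p 0).2 ∧ 0 < (p t - p 0).1 := by
    intro t ht ht'
    have h1 := hmin t
    have h2 := hne 0 t (by omega) (by omega)
    rw [ne_eq, Prod.ext_iff] at h2
    simp only [Prod.fst_sub, Prod.snd_sub]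
    omega
  have htel : ∀ m, 1 ≤ m → m ≤ n + 2 →
      ∑ t ∈ Finset.Ico 1 m, rayCrossing (p t - p 0) (p (t + 1) - p 0) =
        if 0 < (p m - p 0).2 then 1 else 0 := by
    intro m hm
    induction m, hm using Nat.le_induction with
    | base => simp [hfirst]
    | succ m hm ih =>
      intro hmn
      have e1 : p (m + 1) - p 0 = p m - p 0 + (p (m + 1) - p m) := by abel
      rw [Finset.sum_Ico_succ_top hm, ih (by omega), e1,
        rayCrossing_eq_sub_of_upper (hp m) (hupper m hm (by omega))
          (by rw [← e1]; exact hupper (m + 1) (by omega) hmn)]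
      ring
  have hR1' : R 1 = ∑ t ∈ Finset.Ico 2 (n + 2), rayCrossing (p t - p 1) (p (t + 1) - p 1) := by
    simp only [hR]
    rw [Finset.sum_Ico_succ_top (by omega), rayCrossing_eq_zero_of_fst_nonpos, add_zero]
    simp [hlast, hfirst]
  rw [htel (n + 2) (by omega) le_rfl, rayCrossing_eq_zero_of_fst_nonpos (by simp [hlast])] at h0
  simp only [hlast, zero_add, add_sub_cancel_left] at h0
  rw [← hR1', hR1, hlastR] at h0
  rw [Finset.sum_range_succ']
  simp at h0
  linarith

/-- The stitches of `S` follow the lattice walk with velocities `a` along rows and `b` along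
columns, every vertex has an even number of them, and they form a connected graph. -/
structure IsOrientedLoop (κ : ℤ) (a b : ℤ → ℤ) (S : Finset Stitch) : Prop where
  row : ∀ j, a j = 1 ∨ a j = -1
  col : ∀ i, b i = 1 ∨ b i = -1
  horiz : ∀ i j, Stitch.horiz i j ∈ S → a j = if Even (i + j + κ) then 1 else -1
  vert : ∀ i j, Stitch.vert i j ∈ S → b i = if Even (i + j + κ) then -1 else 1
  degree : ∀ i j, (Stitch.horiz i j ∈ S ∨ Stitch.horiz (i - 1) j ∈ S) ↔
    (Stitch.vert i j ∈ S ∨ Stitch.vert i (j - 1) ∈ S)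
  connected : ∀ Q : Set (ℤ × ℤ),
    (∀ i j, Stitch.horiz i j ∈ S → ((i, j) ∈ Q ↔ (i + 1, j) ∈ Q)) →
    (∀ i j, Stitch.vert i j ∈ S → ((i, j) ∈ Q ↔ (i, j + 1) ∈ Q)) →
    ∀ i j i' j', Stitch.horiz i j ∈ S → (i, j) ∈ Q → Stitch.horiz i' j' ∈ S → (i', j') ∈ Q

/-- The two endpoints of a stitch. -/
def Stitch.ends : Stitch → Finset (ℤ × ℤ)
  | .vert i j => {(i, j), (i, j + 1)}
  | .horiz i j => {(i, j), (i + 1, j)}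

/-- The endpoints of a finite set of stitches. -/
def stitchVerts (S : Finset Stitch) : Finset (ℤ × ℤ) := S.biUnion Stitch.ends

lemma mem_stitchVerts {S : Finset Stitch} {i j : ℤ} : (i, j) ∈ stitchVerts S ↔
    (Stitch.horiz i j ∈ S ∨ Stitch.horiz (i - 1) j ∈ S) ∨
      (Stitch.vert i j ∈ S ∨ Stitch.vert i (j - 1) ∈ S) := by
  simp only [stitchVerts, Finset.mem_biUnion]
  constructor
  · rintro ⟨s, hs, h⟩
    cases s <;> simp only [Stitch.ends, Finset.mem_insert, Finset.mem_singleton, Prod.mk.injEq] at h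
      <;> rcases h with ⟨rfl, rfl⟩ | ⟨rfl, rfl⟩ <;> simp [hs]
  · rintro ((h | h) | (h | h)) <;> exact ⟨_, h, by simp [Stitch.ends]⟩

/-- The function `g` on cells takes equal values on neighbouring cells not separated by `S`. -/
structure ConstantOff {γ : Type*} (S : Finset Stitch) (g : ℤ → ℤ → γ) : Prop where
  horiz : ∀ i j, Stitch.horiz i j ∉ S → g i (j - 1) = g i j
  vert : ∀ i j, Stitch.vert i j ∉ S → g (i - 1) j = g i j

/-- The value of `g` on the cell to the left of the step of the lattice walk out of `v`. -/
def leftValue {γ : Type*} (κ : ℤ) (a b : ℤ → ℤ) (g : ℤ → ℤ → γ) (v : ℤ × ℤ) : γ :=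
  if Even (v.1 + v.2 + κ) then
    (if a v.2 = 1 then g v.1 v.2 else g (v.1 - 1) (v.2 - 1))
  else (if b v.1 = 1 then g (v.1 - 1) v.2 else g v.1 (v.2 - 1))

/-- The value of `g` on the cell to the right of the step of the lattice walk out of `v`. -/
def rightValue {γ : Type*} (κ : ℤ) (a b : ℤ → ℤ) (g : ℤ → ℤ → γ) (v : ℤ × ℤ) : γ :=
  if Even (v.1 + v.2 + κ) then
    (if a v.2 = 1 then g v.1 (v.2 - 1) else g (v.1 - 1) v.2)
  else (if b v.1 = 1 then g v.1 v.2 else g (v.1 - 1) (v.2 - 1))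

/-- The values of `g` on the cells to the left and to the right of the step into `v`. -/
lemma leftValue_latticeStepBack {γ : Type*} {κ : ℤ} {a b : ℤ → ℤ}
    (ha : ∀ j, a j = 1 ∨ a j = -1) (hb : ∀ i, b i = 1 ∨ b i = -1) (g : ℤ → ℤ → γ) (v : ℤ × ℤ) :
    leftValue κ a b g (latticeStepBack κ a b v) = if Even (v.1 + v.2 + κ) then
      (if b v.1 = 1 then g (v.1 - 1) (v.2 - 1) else g v.1 v.2)
    else (if a v.2 = 1 then g (v.1 - 1) v.2 else g v.1 (v.2 - 1)) := by
  have h := even_latticeStep (κ := κ) ha hb (latticeStepBack κ a b v)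
  rw [latticeStep_latticeStepBack ha hb] at h
  by_cases hv : Even (v.1 + v.2 + κ)
  · have h' := h.1 hv
    simp only [latticeStepBack, if_pos hv] at h' ⊢
    rw [leftValue, if_neg h']
    rcases hb v.1 with h1 | h1 <;> simp [h1]
  · have h' := not_not.1 (mt h.2 hv)
    simp only [latticeStepBack, if_neg hv] at h' ⊢
    rw [leftValue, if_pos h']
    rcases ha v.2 with h1 | h1 <;> simp [h1]

lemma rightValue_latticeStepBack {γ : Type*} {κ : ℤ} {a b : ℤ → ℤ}
    (ha : ∀ j, a j = 1 ∨ a j = -1) (hb : ∀ i, b i = 1 ∨ b i = -1) (g : ℤ → ℤ → γ) (v : ℤ × ℤ) :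
    rightValue κ a b g (latticeStepBack κ a b v) = if Even (v.1 + v.2 + κ) then
      (if b v.1 = 1 then g v.1 (v.2 - 1) else g (v.1 - 1) v.2)
    else (if a v.2 = 1 then g (v.1 - 1) (v.2 - 1) else g v.1 v.2) := by
  have h := even_latticeStep (κ := κ) ha hb (latticeStepBack κ a b v)
  rw [latticeStep_latticeStepBack ha hb] at h
  by_cases hv : Even (v.1 + v.2 + κ)
  · have h' := h.1 hv
    simp only [latticeStepBack, if_pos hv] at h' ⊢
    rw [rightValue, if_neg h']
    rcases hb v.1 with h1 | h1 <;> simp [h1]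
  · have h' := not_not.1 (mt h.2 hv)
    simp only [latticeStepBack, if_neg hv] at h' ⊢
    rw [rightValue, if_pos h']
    rcases ha v.2 with h1 | h1 <;> simp [h1]

namespace IsOrientedLoop

variable {κ : ℤ} {a b : ℤ → ℤ} {S : Finset Stitch}

lemma horiz_sub_one (h : IsOrientedLoop κ a b S) {i j : ℤ} (hs : Stitch.horiz (i - 1) j ∈ S) :
    a j = if Even (i + j + κ) then -1 else 1 := by
  rw [h.horiz _ _ hs]
  grind

lemma vert_sub_one (h : IsOrientedLoop κ a b S) {i j : ℤ} (hs : Stitch.vert i (j - 1) ∈ S) :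
    b i = if Even (i + j + κ) then 1 else -1 := by
  rw [h.vert _ _ hs]
  grind

lemma leftValue_eq_back (h : IsOrientedLoop κ a b S) {γ : Type*} {g : ℤ → ℤ → γ}
    (hg : ConstantOff S g) (v : ℤ × ℤ) :
    leftValue κ a b g v = leftValue κ a b g (latticeStepBack κ a b v) := by
  rw [leftValue_latticeStepBack h.row h.col, leftValue]
  obtain ⟨i, j⟩ := v
  have h1 := hg.horiz i j
  have h2 := hg.horiz (i - 1) j
  have h3 := hg.vert i j
  have h4 := hg.vert i (j - 1)
  have h5 := h.horiz i j
  have h6 := h.horiz_sub_one (i := i) (j := j)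
  have h7 := h.vert i j
  have h8 := h.vert_sub_one (i := i) (j := j)
  rcases h.row j with ha | ha <;> rcases h.col i with hb | hb <;>
    by_cases hv : Even (i + j + κ) <;> simp_all

lemma rightValue_eq_back (h : IsOrientedLoop κ a b S) {γ : Type*} {g : ℤ → ℤ → γ}
    (hg : ConstantOff S g) (v : ℤ × ℤ) :
    rightValue κ a b g v = rightValue κ a b g (latticeStepBack κ a b v) := by
  rw [rightValue_latticeStepBack h.row h.col, rightValue]
  obtain ⟨i, j⟩ := v
  have h1 := hg.horiz i j
  have h2 := hg.horiz (i - 1) j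
  have h3 := hg.vert i j
  have h4 := hg.vert i (j - 1)
  have h5 := h.horiz i j
  have h6 := h.horiz_sub_one (i := i) (j := j)
  have h7 := h.vert i j
  have h8 := h.vert_sub_one (i := i) (j := j)
  rcases h.row j with ha | ha <;> rcases h.col i with hb | hb <;>
    by_cases hv : Even (i + j + κ) <;> simp_all

lemma leftValue_latticeStep (h : IsOrientedLoop κ a b S) {γ : Type*} {g : ℤ → ℤ → γ}
    (hg : ConstantOff S g) (v : ℤ × ℤ) :
    leftValue κ a b g (latticeStep κ a b v) = leftValue κ a b g v := by
  rw [h.leftValue_eq_back hg, latticeStepBack_latticeStep h.row h.col]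

lemma rightValue_latticeStep (h : IsOrientedLoop κ a b S) {γ : Type*} {g : ℤ → ℤ → γ}
    (hg : ConstantOff S g) (v : ℤ × ℤ) :
    rightValue κ a b g (latticeStep κ a b v) = rightValue κ a b g v := by
  rw [h.rightValue_eq_back hg, latticeStepBack_latticeStep h.row h.col]

/-- The four cells around a vertex of the loop, counted where `g` is one, if `g` is one to the
left of the loop and zero to the right of it. -/
lemma corner_count (h : IsOrientedLoop κ a b S) {g : ℤ → ℤ → ℤ} (hg : ConstantOff S g)
    {v : ℤ × ℤ} (hl : leftValue κ a b g v = 1) (hr : rightValue κ a b g v = 0) :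
    g v.1 v.2 + g (v.1 - 1) v.2 + g v.1 (v.2 - 1) + g (v.1 - 1) (v.2 - 1) =
      2 - paritySign κ v * (a v.2 * b v.1) := by
  have hl' := (h.leftValue_eq_back hg v).symm.trans hl
  have hr' := (h.rightValue_eq_back hg v).symm.trans hr
  rw [leftValue_latticeStepBack h.row h.col] at hl'
  rw [rightValue_latticeStepBack h.row h.col] at hr'
  rw [leftValue] at hl
  rw [rightValue] at hr
  obtain ⟨i, j⟩ := v
  have h1 := fun hne => hg.horiz i j (mt (h.horiz i j) hne)
  have h2 := fun hne => hg.horiz (i - 1) j (mt h.horiz_sub_one hne)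
  have h3 := fun hne => hg.vert i j (mt (h.vert i j) hne)
  have h4 := fun hne => hg.vert i (j - 1) (mt h.vert_sub_one hne)
  unfold paritySign
  rcases h.row j with ha | ha <;> rcases h.col i with hb | hb <;>
    by_cases hv : Even (i + j + κ) <;> simp only [ha, hb, hv, if_true, if_false] at * <;> grind

lemma mem_verts (h : IsOrientedLoop κ a b S) {i j : ℤ} : (i, j) ∈ stitchVerts S ↔
    (Stitch.horiz i j ∈ S ∨ Stitch.horiz (i - 1) j ∈ S) := by
  rw [mem_stitchVerts, ← h.degree, or_self]

lemma mem_verts' (h : IsOrientedLoop κ a b S) {i j : ℤ} : (i, j) ∈ stitchVerts S ↔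
    (Stitch.vert i j ∈ S ∨ Stitch.vert i (j - 1) ∈ S) := by
  rw [mem_stitchVerts, h.degree, or_self]

lemma latticeStep_mem (h : IsOrientedLoop κ a b S) {v : ℤ × ℤ} (hv : v ∈ stitchVerts S) :
    latticeStep κ a b v ∈ stitchVerts S := by
  obtain ⟨i, j⟩ := v
  by_cases hp : Even (i + j + κ)
  · rw [latticeStep_of_even hp, h.mem_verts]
    rcases h.mem_verts.1 hv with hs | hs
    · have := h.horiz _ _ hs
      rw [if_pos hp] at this
      right; simpa [this] using hs
    · have := h.horiz_sub_one hs
      rw [if_pos hp] at this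
      left; simpa [this, ← sub_eq_add_neg] using hs
  · rw [latticeStep_of_odd hp, h.mem_verts']
    rcases h.mem_verts'.1 hv with hs | hs
    · have := h.vert _ _ hs
      rw [if_neg hp] at this
      right; simpa [this] using hs
    · have := h.vert_sub_one hs
      rw [if_neg hp] at this
      left; simpa [this, ← sub_eq_add_neg] using hs

lemma mem_of_latticeStep_mem (h : IsOrientedLoop κ a b S) {v : ℤ × ℤ}
    (hv : latticeStep κ a b v ∈ stitchVerts S) : v ∈ stitchVerts S := by
  have himg : (stitchVerts S).image (latticeStep κ a b) = stitchVerts S :=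
    Finset.eq_of_subset_of_card_le (Finset.image_subset_iff.2 fun _ => h.latticeStep_mem)
      (Finset.card_image_of_injective _ (latticeStep_injective h.row h.col)).ge
  rw [← himg, Finset.mem_image] at hv
  obtain ⟨u, hu, huv⟩ := hv
  rwa [← latticeStep_injective h.row h.col huv]

/-- The walk from a vertex of the loop visits all its vertices. -/
lemma exists_iterate_eq (h : IsOrientedLoop κ a b S) {u v : ℤ × ℤ} (hu : u ∈ stitchVerts S)
    (hv : v ∈ stitchVerts S) : ∃ k, (latticeStep κ a b)^[k] u = v := by
  have hinj := latticeStep_injective (κ := κ) h.row h.col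
  have hiter : ∀ k, (latticeStep κ a b)^[k] u ∈ stitchVerts S := fun k => by
    induction k with
    | zero => exact hu
    | succ k ih => rw [Function.iterate_succ_apply']; exact h.latticeStep_mem ih
  obtain ⟨m, n, hmn, he⟩ : ∃ m n, m < n ∧ (latticeStep κ a b)^[m] u = (latticeStep κ a b)^[n] u := by
    obtain ⟨m, n, hne, he⟩ := Finite.exists_ne_map_eq_of_infinite
      (fun k => (⟨_, hiter k⟩ : stitchVerts S))
    rw [Subtype.mk.injEq] at he
    rcases hne.lt_or_gt with hlt | hlt
    · exact ⟨m, n, hlt, he⟩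
    · exact ⟨n, m, hlt, he.symm⟩
  have hper : (latticeStep κ a b)^[n - m] u = u := by
    apply hinj.iterate m
    rw [← Function.iterate_add_apply, Nat.add_sub_cancel' hmn.le, he]
  set Q : Set (ℤ × ℤ) := {w | ∃ k, (latticeStep κ a b)^[k] u = w} with hQ
  have hstep : ∀ w, w ∈ Q ↔ latticeStep κ a b w ∈ Q := by
    intro w
    constructor
    · rintro ⟨k, rfl⟩
      exact ⟨k + 1, Function.iterate_succ_apply' _ _ _⟩
    · rintro ⟨k, hk⟩
      refine ⟨k + (n - m - 1), hinj ?_⟩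
      rw [← Function.iterate_succ_apply' (latticeStep κ a b), ← hk, ← Nat.add_succ,
        show (n - m - 1).succ = n - m by omega, Function.iterate_add_apply, hper]
  have hH : ∀ i j, Stitch.horiz i j ∈ S → ((i, j) ∈ Q ↔ (i + 1, j) ∈ Q) := by
    intro i j hs
    have ha := h.horiz _ _ hs
    by_cases hp : Even (i + j + κ)
    · rw [hstep (i, j), latticeStep_of_even hp, ha, if_pos hp]
    · rw [if_neg hp] at ha
      rw [hstep (i + 1, j), latticeStep_of_even (by grind), ha]
      simp
  have hV : ∀ i j, Stitch.vert i j ∈ S → ((i, j) ∈ Q ↔ (i, j + 1) ∈ Q) := by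
    intro i j hs
    have hb := h.vert _ _ hs
    by_cases hp : Even (i + j + κ)
    · rw [if_pos hp] at hb
      rw [hstep (i, j + 1), latticeStep_of_odd (by grind), hb]
      simp
    · rw [hstep (i, j), latticeStep_of_odd hp, hb, if_neg hp]
  have hend : ∀ w ∈ stitchVerts S, ∃ i j, Stitch.horiz i j ∈ S ∧ ((i, j) ∈ Q ↔ w ∈ Q) := by
    rintro ⟨i, j⟩ hw
    rcases h.mem_verts.1 hw with hs | hs
    · exact ⟨i, j, hs, Iff.rfl⟩
    · exact ⟨i - 1, j, hs, by simpa using hH _ _ hs⟩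
  obtain ⟨i, j, hs, hiff⟩ := hend u hu
  obtain ⟨i', j', hs', hiff'⟩ := hend v hv
  exact hiff'.1 (h.connected Q hH hV i j i' j' hs (hiff.2 ⟨0, rfl⟩) hs')

end IsOrientedLoop

/-- Whether a stitch is a horizontal one in column `i`, at height at most `j`. -/
def Stitch.below (i j : ℤ) : Stitch → ZMod 2
  | .vert _ _ => 0
  | .horiz i' j' => if i' = i ∧ j' ≤ j then 1 else 0

/-- The parity of the number of horizontal stitches below a cell. -/
def cellParity (S : Finset Stitch) (i j : ℤ) : ZMod 2 := ∑ s ∈ S, s.below i j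

lemma cellParity_eq_add (S : Finset Stitch) (i j : ℤ) :
    cellParity S i j = cellParity S i (j - 1) + if Stitch.horiz i j ∈ S then 1 else 0 := by
  rw [← Finset.sum_ite_eq' S (Stitch.horiz i j) (fun _ => (1 : ZMod 2)), cellParity, cellParity,
    ← Finset.sum_add_distrib]
  refine Finset.sum_congr rfl fun s _ => ?_
  cases s with
  | vert => simp [Stitch.below]
  | horiz i' j' =>
    simp only [Stitch.below, Stitch.horiz.injEq]
    split_ifs <;> first | omega | simp

lemma cellParity_eq_zero {S : Finset Stitch} {i j : ℤ}
    (h : ∀ k ≤ j, Stitch.horiz i k ∉ S) : cellParity S i j = 0 := by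
  refine Finset.sum_eq_zero fun s hs => ?_
  cases s with
  | vert => rfl
  | horiz i' j' =>
    refine if_neg ?_
    rintro ⟨rfl, hj⟩
    exact h _ hj hs

lemma exists_stitch_bound (S : Finset Stitch) : ∃ M : ℤ, 0 ≤ M ∧
    (∀ i j, Stitch.horiz i j ∈ S → -M < i ∧ i < M ∧ -M < j ∧ j < M) ∧
    ∀ i j, Stitch.vert i j ∈ S → -M < i ∧ i < M ∧ -M < j ∧ j < M := by
  obtain ⟨M, hM⟩ := ((stitchVerts S).image fun v => |v.1| + |v.2|).exists_le
  have h : ∀ i j, (i, j) ∈ stitchVerts S → |i| + |j| ≤ M := fun i j hij =>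
    hM _ (Finset.mem_image_of_mem (fun v : ℤ × ℤ => |v.1| + |v.2|) hij)
  refine ⟨|M| + 1, by positivity, fun i j hs => ?_, fun i j hs => ?_⟩
  · have := h i j (mem_stitchVerts.2 (by tauto)); grind
  · have := h i j (mem_stitchVerts.2 (by tauto)); grind

/-- `v` is the leftmost among the lowest vertices of `S`. -/
def IsLowest (S : Finset Stitch) (v : ℤ × ℤ) : Prop :=
  v ∈ stitchVerts S ∧ ∀ u ∈ stitchVerts S, v.2 < u.2 ∨ v.2 = u.2 ∧ v.1 ≤ u.1

lemma exists_isLowest {S : Finset Stitch} (hS : S.Nonempty) : ∃ v, IsLowest S v := by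
  have hne : (stitchVerts S).Nonempty := by
    obtain ⟨s, hs⟩ := hS
    cases s with
    | vert i j => exact ⟨(i, j), mem_stitchVerts.2 (by tauto)⟩
    | horiz i j => exact ⟨(i, j), mem_stitchVerts.2 (by tauto)⟩
  obtain ⟨v, hv, hmin⟩ := Finset.exists_min_image (stitchVerts S)
    (fun v => toLex (v.2, v.1)) hne
  exact ⟨v, hv, fun u hu => by simpa [Prod.Lex.le_iff] using hmin u hu⟩

lemma ConstantOff.comp {γ δ : Type*} {S : Finset Stitch} {g : ℤ → ℤ → γ} (hg : ConstantOff S g)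
    (f : γ → δ) : ConstantOff S fun i j => f (g i j) :=
  ⟨fun i j h => congrArg f (hg.horiz i j h), fun i j h => congrArg f (hg.vert i j h)⟩

namespace IsOrientedLoop

variable {κ : ℤ} {a b : ℤ → ℤ} {S : Finset Stitch}

lemma cellParity_eq_add_col (h : IsOrientedLoop κ a b S) (i j : ℤ) :
    cellParity S i j = cellParity S (i - 1) j + if Stitch.vert i j ∈ S then 1 else 0 := by
  obtain ⟨M, hM, hH, hV⟩ := exists_stitch_bound S
  have hlow : ∀ j ≤ -M, cellParity S i j =
      cellParity S (i - 1) j + if Stitch.vert i j ∈ S then 1 else 0 := by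
    intro j hj
    rw [cellParity_eq_zero, cellParity_eq_zero, if_neg, add_zero]
    · intro hs; have := hV _ _ hs; omega
    · intro k hk hs; have := hH _ _ hs; omega
    · intro k hk hs; have := hH _ _ hs; omega
  rcases le_total j (-M) with hj | hj
  · exact hlow j hj
  induction j, hj using Int.leInduction with
  | base => exact hlow _ le_rfl
  | succ j hj ih =>
    rw [cellParity_eq_add, cellParity_eq_add S (i - 1), add_sub_cancel_right, ih]
    have hdeg := h.degree i (j + 1)
    rw [add_sub_cancel_right] at hdeg
    have h1 : Stitch.horiz i (j + 1) ∈ S → ¬ Stitch.horiz (i - 1) (j + 1) ∈ S := fun h1 h2 => by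
      have := h.horiz _ _ h1
      rw [h.horiz_sub_one h2] at this
      split_ifs at this
    have h2 : Stitch.vert i (j + 1) ∈ S → ¬ Stitch.vert i j ∈ S := fun h1 h2 => by
      have := h.vert _ _ h1
      rw [h.vert _ _ h2] at this
      grind
    have h3 : (1 + 1 : ZMod 2) = 0 := by decide
    generalize cellParity S (i - 1) j = x
    by_cases c1 : Stitch.horiz i (j + 1) ∈ S <;> by_cases c2 : Stitch.horiz (i - 1) (j + 1) ∈ S <;>
      by_cases c3 : Stitch.vert i (j + 1) ∈ S <;> by_cases c4 : Stitch.vert i j ∈ S <;>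
      simp only [c1, c2, c3, c4, if_true, if_false] <;> first | (exfalso; tauto) | grind

lemma constantOff_cellParity (h : IsOrientedLoop κ a b S) : ConstantOff S (cellParity S) where
  horiz i j hs := by rw [cellParity_eq_add S i j, if_neg hs, add_zero]
  vert i j hs := by rw [h.cellParity_eq_add_col i j, if_neg hs, add_zero]

lemma cellParity_bound (h : IsOrientedLoop κ a b S) : ∃ M : ℤ, ∀ i j, cellParity S i j ≠ 0 →
    -M ≤ i ∧ i ≤ M ∧ -M ≤ j ∧ j ≤ M := by
  obtain ⟨M, hM, hH, hV⟩ := exists_stitch_bound S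
  have hcol : ∀ i j, i ≤ -M ∨ M ≤ i → cellParity S i j = 0 := fun i j hi =>
    cellParity_eq_zero fun k _ hs => by have := hH _ _ hs; omega
  refine ⟨M, fun i j hij => ?_⟩
  by_contra hc
  apply hij
  by_cases h1 : i ≤ -M ∨ M ≤ i
  · exact hcol i j h1
  by_cases h2 : j < -M
  · exact cellParity_eq_zero fun k _ hs => by have := hH _ _ hs; omega
  have hle : -M ≤ i := by omega
  have hj : M < j := by omega
  clear h1 hc hij
  induction i, hle using Int.leInduction with
  | base => exact hcol _ _ (by omega)
  | succ i hi ih =>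
    rw [h.cellParity_eq_add_col, add_sub_cancel_right, if_neg, add_zero]
    · by_cases h1 : i ≤ -M ∨ M ≤ i
      · exact hcol i j h1
      · exact ih
    · intro hs; have := hV _ _ hs; omega

lemma lowest_stitches (h : IsOrientedLoop κ a b S) {i j : ℤ} (hv : IsLowest S (i, j))
    (hp : Even (i + j + κ)) : Stitch.horiz i j ∈ S ∧ a j = 1 ∧ b i = -1 := by
  have hH : Stitch.horiz i j ∈ S := by
    rcases h.mem_verts.1 hv.1 with hs | hs
    · exact hs
    · have := hv.2 (i - 1, j) (mem_stitchVerts.2 (by tauto))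
      simp only at this; omega
  have hV : Stitch.vert i j ∈ S := by
    rcases h.mem_verts'.1 hv.1 with hs | hs
    · exact hs
    · have := hv.2 (i, j - 1) (mem_stitchVerts.2 (by tauto))
      simp only at this; omega
  exact ⟨hH, by rw [h.horiz _ _ hH, if_pos hp], by rw [h.vert _ _ hV, if_pos hp]⟩

end IsOrientedLoop

lemma IsLowest.horiz_notMem {S : Finset Stitch} {i j : ℤ} (hv : IsLowest S (i, j)) {i' k : ℤ}
    (hk : k < j) : Stitch.horiz i' k ∉ S := fun hs => by
  have := hv.2 (i', k) (mem_stitchVerts.2 (by tauto))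
  simp only at this; omega

namespace IsOrientedLoop

variable {κ : ℤ} {a b : ℤ → ℤ} {S : Finset Stitch}

/-- A quantity preserved by the walk is constant along the loop. -/
lemma eq_of_invariant (h : IsOrientedLoop κ a b S) {γ : Type*} {f : ℤ × ℤ → γ}
    (hf : ∀ v, f (latticeStep κ a b v) = f v) {u v : ℤ × ℤ} (hu : u ∈ stitchVerts S)
    (hv : v ∈ stitchVerts S) : f v = f u := by
  obtain ⟨k, rfl⟩ := h.exists_iterate_eq hu hv
  clear hv
  induction k with
  | zero => rfl
  | succ k ih => rw [Function.iterate_succ_apply', hf, ih]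

lemma leftValue_cellParity (h : IsOrientedLoop κ a b S) {v₀ v : ℤ × ℤ} (hv₀ : IsLowest S v₀)
    (hp : Even (v₀.1 + v₀.2 + κ)) (hv : v ∈ stitchVerts S) :
    leftValue κ a b (cellParity S) v = 1 := by
  obtain ⟨i, j⟩ := v₀
  obtain ⟨hH, ha, hb⟩ := h.lowest_stitches hv₀ hp
  rw [h.eq_of_invariant (h.leftValue_latticeStep h.constantOff_cellParity) hv₀.1 hv, leftValue,
    if_pos hp, if_pos ha, cellParity_eq_add, if_pos hH, cellParity_eq_zero, zero_add]
  exact fun k hk => hv₀.horiz_notMem (by simp only at hk; omega)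

lemma rightValue_cellParity (h : IsOrientedLoop κ a b S) {v₀ v : ℤ × ℤ} (hv₀ : IsLowest S v₀)
    (hp : Even (v₀.1 + v₀.2 + κ)) (hv : v ∈ stitchVerts S) :
    rightValue κ a b (cellParity S) v = 0 := by
  obtain ⟨i, j⟩ := v₀
  obtain ⟨hH, ha, hb⟩ := h.lowest_stitches hv₀ hp
  rw [h.eq_of_invariant (h.rightValue_latticeStep h.constantOff_cellParity) hv₀.1 hv, rightValue,
    if_pos hp, if_pos ha, cellParity_eq_zero]
  exact fun k hk => hv₀.horiz_notMem (by simp only at hk; omega)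

/-- Cells of parity zero can be joined, without crossing `S`, to cells that are arbitrarily far
below. -/
lemma exists_eq_of_cellParity_eq_zero (h : IsOrientedLoop κ a b S) {v₀ : ℤ × ℤ}
    (hv₀ : IsLowest S v₀) (hp : Even (v₀.1 + v₀.2 + κ)) {γ : Type*} {g : ℤ → ℤ → γ}
    (hg : ConstantOff S g) {i j : ℤ} (hij : cellParity S i j = 0) :
    ∃ i' j', ∀ k ≤ j', g i' k = g i j := by
  have hdown : ∀ i j, (∀ k ≤ j, Stitch.horiz i k ∉ S) → ∀ k ≤ j, g i k = g i j := by
    intro i j hs k hk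
    induction k, hk using Int.leInductionDown with
    | base => rfl
    | pred k hk ih => rw [hg.horiz i k (hs k hk), ih]
  have hlow : ∀ j < v₀.2, ∃ i' j', ∀ k ≤ j', g i' k = g i j := fun j hj =>
    ⟨i, j, hdown i j fun k hk => hv₀.horiz_notMem (j := v₀.2) (by omega)⟩
  rcases lt_or_ge j v₀.2 with hj | hj
  · exact hlow j hj
  have hj' : v₀.2 - 1 ≤ j := by omega
  clear hj
  induction j, hj' using Int.leInduction with
  | base => exact hlow _ (by omega)
  | succ j hj ih =>
    rw [cellParity_eq_add, add_sub_cancel_right] at hij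
    by_cases hs : Stitch.horiz i (j + 1) ∈ S
    · have hends : (i, j + 1) ∈ stitchVerts S ∧ (i + 1, j + 1) ∈ stitchVerts S :=
        ⟨mem_stitchVerts.2 (by tauto), mem_stitchVerts.2 (by simp [hs])⟩
      have ha := h.horiz _ _ hs
      have hodd : ¬ Even (i + (j + 1) + κ) := by
        intro he
        have h1 := h.leftValue_cellParity hv₀ hp hends.1
        rw [if_pos he] at ha
        rw [leftValue, if_pos he, if_pos ha, cellParity_eq_add, add_sub_cancel_right, hij] at h1
        exact absurd h1 (by decide)
      rw [if_neg hodd] at ha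
      have h1 : rightValue κ a b g (i + 1, j + 1) = g i (j + 1) := by
        rw [rightValue, if_pos (by grind), if_neg (by simp [ha])]
        simp
      obtain ⟨i₀, j₀⟩ := v₀
      obtain ⟨hH, ha₀, hb₀⟩ := h.lowest_stitches hv₀ hp
      refine ⟨i₀, j₀ - 1, fun k hk => ?_⟩
      rw [← h1, h.eq_of_invariant (h.rightValue_latticeStep hg) hv₀.1 hends.2, rightValue,
        if_pos hp, if_pos ha₀]
      exact hdown i₀ (j₀ - 1) (fun k hk => hv₀.horiz_notMem (by omega)) k hk
    · rw [if_neg hs, add_zero] at hij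
      have := hg.horiz _ _ hs
      rw [add_sub_cancel_right] at this
      rw [← this]
      exact ih hij

end IsOrientedLoop

lemma sum_ite_sub_mem {B F : Finset (ℤ × ℤ)} (t : ℤ × ℤ) (h : ∀ v ∈ F, v + t ∈ B) :
    ∑ v ∈ B, (if v - t ∈ F then (1 : ℤ) else 0) = F.card := by
  rw [Finset.sum_boole, ← Finset.card_map (addRightEmbedding t) (s := F)]
  congr 2
  ext v
  simp only [Finset.mem_filter, Finset.mem_map, addRightEmbedding_apply]
  constructor
  · rintro ⟨_, hv⟩
    exact ⟨_, hv, sub_add_cancel _ _⟩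
  · rintro ⟨u, hu, rfl⟩
    exact ⟨h u hu, by simpa using hu⟩

lemma sum_paritySign_mul_snd {κ : ℤ} {a b : ℤ → ℤ} (ha : ∀ j, a j = 1 ∨ a j = -1)
    (hb : ∀ i, b i = 1 ∨ b i = -1) {P : Finset (ℤ × ℤ)} (hP : ∀ v ∈ P, latticeStep κ a b v ∈ P)
    (f : ℤ → ℤ) : ∑ v ∈ P, paritySign κ v * f v.2 = 0 := by
  have h := sum_comp_latticeStep ha hb hP (fun v => if Even (v.1 + v.2 + κ) then 0 else f v.2)
  simp only [even_latticeStep ha hb] at h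
  rw [← sub_eq_zero, ← Finset.sum_sub_distrib] at h
  rw [← neg_eq_zero, ← Finset.sum_neg_distrib, ← h]
  refine Finset.sum_congr rfl fun v _ => ?_
  by_cases hv : Even (v.1 + v.2 + κ) <;> simp [paritySign, latticeStep, hv]

lemma sum_paritySign_mul_fst {κ : ℤ} {a b : ℤ → ℤ} (ha : ∀ j, a j = 1 ∨ a j = -1)
    (hb : ∀ i, b i = 1 ∨ b i = -1) {P : Finset (ℤ × ℤ)} (hP : ∀ v ∈ P, latticeStep κ a b v ∈ P)
    (f : ℤ → ℤ) : ∑ v ∈ P, paritySign κ v * f v.1 = 0 := by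
  have h := sum_comp_latticeStep ha hb hP (fun v => if Even (v.1 + v.2 + κ) then f v.1 else 0)
  simp only [even_latticeStep ha hb] at h
  rw [← sub_eq_zero, ← Finset.sum_sub_distrib] at h
  rw [← h]
  refine Finset.sum_congr rfl fun v _ => ?_
  by_cases hv : Even (v.1 + v.2 + κ) <;> simp [paritySign, latticeStep, hv]

lemma isUnitStep_latticeStep {κ : ℤ} {a b : ℤ → ℤ} (ha : ∀ j, a j = 1 ∨ a j = -1)
    (hb : ∀ i, b i = 1 ∨ b i = -1) (v : ℤ × ℤ) : IsUnitStep (latticeStep κ a b v - v) := by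
  obtain ⟨i, j⟩ := v
  unfold latticeStep IsUnitStep
  split_ifs
  · rcases ha j with h | h <;> simp [h]
  · rcases hb i with h | h <;> simp [h]

/-- The corners of the walk that contribute to its rotation number are those between two
positive steps. -/
lemma cornerCrossing_iterate_latticeStep {κ : ℤ} {a b : ℤ → ℤ} (ha : ∀ j, a j = 1 ∨ a j = -1)
    (hb : ∀ i, b i = 1 ∨ b i = -1) (v : ℤ × ℤ) (s : ℕ) :
    cornerCrossing (fun k => (latticeStep κ a b)^[k] v) s =
      paritySign κ ((latticeStep κ a b)^[s + 1] v) *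
        if a ((latticeStep κ a b)^[s + 1] v).2 = 1 ∧ b ((latticeStep κ a b)^[s + 1] v).1 = 1
          then 1 else 0 := by
  have h1 : (latticeStep κ a b)^[s] v =
      latticeStepBack κ a b ((latticeStep κ a b)^[s + 1] v) := by
    rw [Function.iterate_succ_apply', latticeStepBack_latticeStep ha hb]
  simp only [cornerCrossing]
  rw [h1, Function.iterate_succ_apply' (latticeStep κ a b) (s + 1)]
  obtain ⟨i, j⟩ := (latticeStep κ a b)^[s + 1] v
  unfold rayCrossing paritySign latticeStep latticeStepBack
  by_cases hv : Even (i + j + κ) <;> rcases ha j with h2 | h2 <;> rcases hb i with h3 | h3 <;>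
    simp [hv, h2, h3]

namespace IsOrientedLoop

variable {κ : ℤ} {a b : ℤ → ℤ} {S : Finset Stitch}

lemma sum_positive_corners (h : IsOrientedLoop κ a b S) {v₀ : ℤ × ℤ} (hv₀ : IsLowest S v₀)
    (hp : Even (v₀.1 + v₀.2 + κ)) :
    ∑ v ∈ stitchVerts S, paritySign κ v * (if a v.2 = 1 ∧ b v.1 = 1 then 1 else 0) = 1 := by
  set p : ℕ → ℤ × ℤ := fun k => (latticeStep κ a b)^[k] v₀ with hpdef
  set N := Function.minimalPeriod (latticeStep κ a b) v₀ with hN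
  have hmem : ∀ k, p k ∈ stitchVerts S := fun k => by
    induction k with
    | zero => exact hv₀.1
    | succ k ih => rw [hpdef]; simp only [Function.iterate_succ_apply']; exact h.latticeStep_mem ih
  have hpos : 0 < N := by
    obtain ⟨k, hk⟩ := h.exists_iterate_eq (h.latticeStep_mem hv₀.1) hv₀.1
    exact Function.minimalPeriod_pos_of_mem_periodicPts
      (Function.mk_mem_periodicPts (Nat.succ_pos k) hk)
  have hpN : p N = p 0 := Function.iterate_minimalPeriod
  have hinj : ∀ s t, s < N → t < N → p s = p t → s = t := fun s t hs ht hst =>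
    Function.iterate_injOn_Iio_minimalPeriod hs ht hst
  obtain ⟨hH, ha, hb⟩ := h.lowest_stitches (i := v₀.1) (j := v₀.2) hv₀ hp
  have hfirst : p 1 = p 0 + (1, 0) := by
    simp [hpdef, latticeStep, hp, ha, Prod.ext_iff]
  have hlast : p (N - 1) = p 0 + (0, 1) := by
    have h1 : latticeStep κ a b (p (N - 1)) = p 0 := by
      rw [← hpN, hpdef]; simp only
      rw [← Function.iterate_succ_apply' (latticeStep κ a b), Nat.succ_eq_add_one, Nat.sub_add_cancel hpos]
    rw [← latticeStepBack_latticeStep h.row h.col (κ := κ) (p (N - 1)), h1]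
    simp [hpdef, latticeStepBack, hp, hb, Prod.ext_iff]
  obtain ⟨n, hn⟩ : ∃ n, N = n + 3 := by
    have h1 : N ≠ 1 := fun h1 => by
      rw [← h1, hpN] at hfirst
      simp [Prod.ext_iff] at hfirst
    have h2 : N ≠ 2 := fun h2 => by
      rw [h2, hfirst] at hlast
      simp at hlast
    exact ⟨N - 3, by omega⟩
  have himg : stitchVerts S = (Finset.range N).image p := by
    ext v
    simp only [Finset.mem_image, Finset.mem_range]
    constructor
    · intro hv
      obtain ⟨k, rfl⟩ := h.exists_iterate_eq hv₀.1 hv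
      exact ⟨k % N, Nat.mod_lt _ hpos, Function.iterate_mod_minimalPeriod_eq⟩
    · rintro ⟨k, _, rfl⟩
      exact hmem k
  rw [himg, Finset.sum_image fun s hs t ht => hinj s t (by simpa using hs) (by simpa using ht), hn,
    Finset.sum_range_succ']
  rw [hn] at hpN hlast hinj
  have key := sum_cornerCrossing (p := p) (n := n)
    (fun k => by
      simp only [hpdef, Function.iterate_succ_apply']
      exact isUnitStep_latticeStep h.row h.col _)
    hpN (fun s t hst ht he => hst.ne (hinj s t (by omega) ht he)) (fun k => hv₀.2 _ (hmem k))
    hfirst hlast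
  simp only [hpdef, cornerCrossing_iterate_latticeStep h.row h.col] at key
  rw [hpdef]
  simp only
  rw [key]
  simp [hb]

/-- The number of cells enclosed by an oriented loop is one modulo four. -/
theorem card_mod_four (h : IsOrientedLoop κ a b S) {v₀ : ℤ × ℤ} (hv₀ : IsLowest S v₀)
    (hp : Even (v₀.1 + v₀.2 + κ)) {F : Finset (ℤ × ℤ)}
    (hF : ∀ i j, (i, j) ∈ F ↔ cellParity S i j = 1) : F.card % 4 = 1 := by
  set L := stitchVerts S with hL
  set α : ℤ → ℤ := fun j => if a j = 1 then 0 else 1 with hα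
  set β : ℤ → ℤ := fun i => if b i = 1 then 0 else 1 with hβ
  have ha' : ∀ j, a j = 1 - 2 * α j := fun j => by rcases h.row j with h1 | h1 <;> simp [hα, h1]
  have hb' : ∀ i, b i = 1 - 2 * β i := fun i => by rcases h.col i with h1 | h1 <;> simp [hβ, h1]
  have hLinv : ∀ v ∈ L, latticeStep κ a b v ∈ L := fun v hv => h.latticeStep_mem hv
  have hIinv : ∀ v ∈ F \ L, latticeStep κ a b v ∈ F \ L := by
    rintro ⟨i, j⟩ hv
    rw [Finset.mem_sdiff] at hv ⊢
    have hout := mt h.mem_of_latticeStep_mem hv.2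
    refine ⟨?_, hout⟩
    have hc := h.constantOff_cellParity
    rw [hF] at hv
    by_cases he : Even (i + j + κ)
    · rw [latticeStep_of_even he] at hout ⊢
      rcases h.row j with h1 | h1
      · rw [h1] at hout ⊢
        rw [hF, ← hv.1, ← hc.vert (i + 1) j fun hs => hout (mem_stitchVerts.2 (by tauto)),
          add_sub_cancel_right]
      · rw [h1, ← sub_eq_add_neg, hF, ← hv.1,
          hc.vert i j fun hs => hv.2 (mem_stitchVerts.2 (by tauto))]
    · rw [latticeStep_of_odd he] at hout ⊢
      rcases h.col i with h1 | h1
      · rw [h1] at hout ⊢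
        rw [hF, ← hv.1, ← hc.horiz i (j + 1) fun hs => hout (mem_stitchVerts.2 (by tauto)),
          add_sub_cancel_right]
      · rw [h1, ← sub_eq_add_neg, hF, ← hv.1,
          hc.horiz i j fun hs => hv.2 (mem_stitchVerts.2 (by tauto))]
  have hI := card_eq_of_mapsTo ha' h.row h.col hIinv
  have hLcard := card_eq_of_mapsTo ha' h.row h.col hLinv
  rw [sum_left_eq hb' h.row h.col hLinv] at hLcard
  have hps := sum_paritySign_mul_snd h.row h.col hLinv fun _ => 1
  have hpa := sum_paritySign_mul_snd h.row h.col hLinv α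
  have hpb := sum_paritySign_mul_fst h.row h.col hLinv β
  have hrot := h.sum_positive_corners hv₀ hp
  have hαβ : ∑ v ∈ L, paritySign κ v * (α v.2 * β v.1) = 1 := by
    have e : ∀ v ∈ L, paritySign κ v * (if a v.2 = 1 ∧ b v.1 = 1 then 1 else 0) =
        paritySign κ v * 1 - paritySign κ v * α v.2 - paritySign κ v * β v.1 +
          paritySign κ v * (α v.2 * β v.1) := by
      intro v _
      by_cases h1 : a v.2 = 1 <;> by_cases h2 : b v.1 = 1 <;> simp [hα, hβ, h1, h2]
    rw [Finset.sum_congr rfl e, Finset.sum_add_distrib, Finset.sum_sub_distrib,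
      Finset.sum_sub_distrib] at hrot
    linarith
  have hab : ∑ v ∈ L, paritySign κ v * (a v.2 * b v.1) = 4 := by
    have e : ∀ v ∈ L, paritySign κ v * (a v.2 * b v.1) =
        paritySign κ v * 1 - 2 * (paritySign κ v * α v.2) - 2 * (paritySign κ v * β v.1) +
          4 * (paritySign κ v * (α v.2 * β v.1)) := by
      intro v _
      rw [ha', hb']; ring
    rw [Finset.sum_congr rfl e, Finset.sum_add_distrib, Finset.sum_sub_distrib,
      Finset.sum_sub_distrib, ← Finset.mul_sum, ← Finset.mul_sum, ← Finset.mul_sum, hps, hpa, hpb,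
      hαβ]
    norm_num
  set w : ℤ → ℤ → ℤ := fun i j => if (i, j) ∈ F then 1 else 0 with hw
  have hwc : ConstantOff S w := by
    have := h.constantOff_cellParity.comp fun x : ZMod 2 => if x = 1 then (1 : ℤ) else 0
    simpa only [← hF] using this
  set T : Finset (ℤ × ℤ) := {(0, 0), (1, 0), (0, 1), (1, 1)} with hT
  set B : Finset (ℤ × ℤ) := L ∪ (F ×ˢ T).image fun x => x.1 + x.2 with hB
  have hFB : ∀ t ∈ T, ∀ v ∈ F, v + t ∈ B := fun t ht v hv => by
    refine Finset.mem_union_right _ (Finset.mem_image.2 ⟨(v, t), ?_, rfl⟩)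
    exact Finset.mem_product.2 ⟨hv, ht⟩
  have hsum : ∑ v ∈ B, (w v.1 v.2 + w (v.1 - 1) v.2 + w v.1 (v.2 - 1) + w (v.1 - 1) (v.2 - 1)) =
      4 * F.card := by
    have e := fun t ht => sum_ite_sub_mem t (hFB t ht)
    have e1 := e (0, 0) (by simp [hT])
    have e2 := e (1, 0) (by simp [hT])
    have e3 := e (0, 1) (by simp [hT])
    have e4 := e (1, 1) (by simp [hT])
    simp only [Prod.sub_def, sub_zero] at e1 e2 e3 e4
    rw [Finset.sum_add_distrib, Finset.sum_add_distrib, Finset.sum_add_distrib]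
    simp only [hw]
    linarith
  have hsplit : ∀ v ∈ B,
      w v.1 v.2 + w (v.1 - 1) v.2 + w v.1 (v.2 - 1) + w (v.1 - 1) (v.2 - 1) =
        (if v ∈ L then 2 - paritySign κ v * (a v.2 * b v.1) else 0) +
          if v ∈ F \ L then 4 else 0 := by
    rintro ⟨i, j⟩ -
    by_cases hv : (i, j) ∈ L
    · rw [if_pos hv, if_neg (by simp [hv]), add_zero]
      apply h.corner_count hwc
      · have := h.leftValue_cellParity hv₀ hp hv
        simp only [leftValue, hw, hF] at this ⊢
        grind
      · have := h.rightValue_cellParity hv₀ hp hv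
        simp only [rightValue, hw, hF] at this ⊢
        grind
    · have h1 := hwc.horiz i j fun hs => hv (mem_stitchVerts.2 (by tauto))
      have h2 := hwc.vert i j fun hs => hv (mem_stitchVerts.2 (by tauto))
      have h3 := hwc.horiz (i - 1) j fun hs => hv (mem_stitchVerts.2 (by tauto))
      simp only
      rw [if_neg hv, h3, h1, h2]
      by_cases hf : (i, j) ∈ F <;> simp [hw, hf, hv]
  rw [Finset.sum_congr rfl hsplit, Finset.sum_add_distrib, Finset.sum_ite_mem, Finset.sum_ite_mem,
    Finset.inter_eq_right.2 Finset.subset_union_left, Finset.inter_eq_right.2, Finset.sum_sub_distrib,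
    hab, Finset.sum_const, Finset.sum_const] at hsum
  · rw [hαβ] at hLcard
    simp only [nsmul_eq_mul] at hsum
    omega
  · intro v hv
    have := hFB (0, 0) (by simp [hT]) v (Finset.mem_sdiff.1 hv).1
    rwa [show v + (0, 0) = v from add_zero v] at this

end IsOrientedLoop

lemma IsOrientedLoop.of_inPattern {ε η : ℤ → ZMod 2} {S : Finset Stitch}
    (hS : ∀ s ∈ S, s.InPattern ε η)
    (hdeg : ∀ i j, (Stitch.horiz i j ∈ S ∨ Stitch.horiz (i - 1) j ∈ S) ↔
      (Stitch.vert i j ∈ S ∨ Stitch.vert i (j - 1) ∈ S))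
    (hconn : ∀ Q : Set (ℤ × ℤ),
      (∀ i j, Stitch.horiz i j ∈ S → ((i, j) ∈ Q ↔ (i + 1, j) ∈ Q)) →
      (∀ i j, Stitch.vert i j ∈ S → ((i, j) ∈ Q ↔ (i, j + 1) ∈ Q)) →
      ∀ i j i' j', Stitch.horiz i j ∈ S → (i, j) ∈ Q → Stitch.horiz i' j' ∈ S → (i', j') ∈ Q)
    (κ : ℤ) :
    IsOrientedLoop κ (fun j => if ((j + κ : ℤ) : ZMod 2) = η j then 1 else -1)
      (fun i => if ((i + κ + 1 : ℤ) : ZMod 2) = ε i then 1 else -1) S where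
  row j := by split_ifs <;> simp
  col i := by split_ifs <;> simp
  horiz i j hs := by
    have h : (i : ZMod 2) = η j := hS _ hs
    have : ((j + κ : ℤ) : ZMod 2) = (i : ℤ) ↔ Even (i + j + κ) := by
      rw [ZMod.intCast_eq_intCast_iff, Int.modEq_iff_dvd, Int.even_iff]
      push_cast
      omega
    simp only [← h, this]
  vert i j hs := by
    have h : (j : ZMod 2) = ε i := hS _ hs
    have : ((i + κ + 1 : ℤ) : ZMod 2) = (j : ℤ) ↔ ¬ Even (i + j + κ) := by
      rw [ZMod.intCast_eq_intCast_iff, Int.modEq_iff_dvd, Int.even_iff]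
      push_cast
      omega
    simp only [← h, this]
    split_ifs <;> rfl
  degree := hdeg
  connected := hconn

section Circle

/-- Removing a point from a sphere leaves a preconnected set. -/
lemma isPreconnected_sphere_diff_singleton {E : Type*} [NormedAddCommGroup E] [NormedSpace ℝ E]
    {p : E} (hp : p ∈ Metric.sphere (0 : E) 1) :
    IsPreconnected (Metric.sphere (0 : E) 1 \ {p}) := by
  have hp1 : ‖p‖ = 1 := by simpa using hp
  have hp0 : p ≠ 0 := by rintro rfl; simp at hp1
  set R : Set E := {x | ∀ t : ℝ, 0 ≤ t → x ≠ t • p} with hR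
  have hstar : StarConvex ℝ (-p) R := by
    intro x hx c s hc hs hcs t ht he
    rcases hs.eq_or_lt with rfl | hs
    · have : (t + c) • p = 0 := by
        rw [add_smul, ← he]; simp
      rcases smul_eq_zero.1 this with h | h
      · linarith
      · exact hp0 h
    · refine hx ((t + c) / s) (by positivity) ?_
      rw [div_eq_inv_mul, mul_smul, add_smul, ← he, eq_inv_smul_iff₀ hs.ne']
      simp
  have hne : -p ∈ R := by
    intro t ht he
    have : (t + 1) • p = 0 := by rw [add_smul, ← he]; simp
    rcases smul_eq_zero.1 this with h | h
    · linarith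
    · exact hp0 h
  have himg : Metric.sphere (0 : E) 1 \ {p} = (fun x : E => ‖x‖⁻¹ • x) '' R := by
    ext x
    constructor
    · rintro ⟨hx, hxp⟩
      have hx1 : ‖x‖ = 1 := by simpa using hx
      refine ⟨x, fun t ht he => hxp ?_, by simp [hx1]⟩
      have : t = 1 := by
        rw [he, norm_smul, hp1, Real.norm_of_nonneg ht, mul_one] at hx1
        exact hx1
      rw [he, this, one_smul]
      rfl
    · rintro ⟨y, hy, rfl⟩
      have hy0 : y ≠ 0 := fun h => hy 0 le_rfl (by simp [h])
      refine ⟨by simp [norm_smul, hy0], fun he => hy ‖y‖ (norm_nonneg _) ?_⟩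
      rw [← Set.mem_singleton_iff.1 he, smul_inv_smul₀ (norm_ne_zero_iff.2 hy0)]
  rw [himg]
  refine (hstar.isPathConnected hne).isConnected.isPreconnected.image _ ?_
  refine ContinuousOn.smul (ContinuousOn.inv₀ continuous_norm.continuousOn fun x hx => ?_)
    continuousOn_id
  exact norm_ne_zero_iff.2 fun h => hx 0 le_rfl (by simp [h])

variable {C : Set (ℝ × ℝ)}

lemma IsCircle.nonempty (hC : IsCircle C) : C.Nonempty := by
  obtain ⟨e⟩ := hC
  exact ⟨_, (e.symm ⟨(1, 0), by simp [Prod.norm_def]⟩).2⟩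

lemma IsCircle.isPreconnected (hC : IsCircle C) : IsPreconnected C := by
  obtain ⟨e⟩ := hC
  have h1 : IsPreconnected (Metric.sphere (0 : ℝ × ℝ) 1) :=
    isPreconnected_sphere (by simp [← Module.finrank_eq_rank]) _ _
  rw [isPreconnected_iff_preconnectedSpace] at h1 ⊢
  rw [preconnectedSpace_iff_univ, ← e.symm.surjective.range_eq]
  exact isPreconnected_range e.symm.continuous

lemma IsCircle.isPreconnected_diff_singleton (hC : IsCircle C) {p : ℝ × ℝ} (hp : p ∈ C) :
    IsPreconnected (C \ {p}) := by
  obtain ⟨e⟩ := hC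
  have h1 := isPreconnected_sphere_diff_singleton (e ⟨p, hp⟩).2
  have h2 : IsPreconnected {x : Metric.sphere (0 : ℝ × ℝ) 1 | x ≠ e ⟨p, hp⟩} := by
    have himg : Subtype.val '' {x : Metric.sphere (0 : ℝ × ℝ) 1 | x ≠ e ⟨p, hp⟩} =
        Metric.sphere (0 : ℝ × ℝ) 1 \ {(e ⟨p, hp⟩ : ℝ × ℝ)} := by
      ext x
      constructor
      · rintro ⟨y, hy, rfl⟩
        exact ⟨y.2, fun h => hy (Subtype.ext h)⟩
      · rintro ⟨hx, hxp⟩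
        exact ⟨⟨x, hx⟩, fun h => hxp (congrArg Subtype.val h), rfl⟩
    rw [← Topology.IsInducing.subtypeVal.isPreconnected_image, himg]
    exact h1
  have h3 := h2.image (fun x => ((e.symm x : C) : ℝ × ℝ)) (by fun_prop)
  convert h3 using 1
  ext x
  constructor
  · rintro ⟨hx, hxp⟩
    refine ⟨e ⟨x, hx⟩, fun h => hxp ?_, by simp⟩
    simpa using h
  · rintro ⟨y, hy, rfl⟩
    refine ⟨(e.symm y).2, fun h => hy ?_⟩
    rw [← e.symm_apply_eq]
    exact Subtype.ext h

end Circle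

section Curve

/-- The midpoint of a stitch. -/
noncomputable def Stitch.midpoint : Stitch → ℝ × ℝ
  | .vert i j => (i, j + 1 / 2)
  | .horiz i j => (i + 1 / 2, j)

lemma Stitch.mem_seg_vert {i j : ℤ} {x : ℝ × ℝ} :
    x ∈ (Stitch.vert i j).seg ↔ x.1 = i ∧ (j : ℝ) ≤ x.2 ∧ x.2 ≤ j + 1 := by
  obtain ⟨x, y⟩ := x
  rw [Stitch.seg, ← Prod.image_mk_segment_right, segment_eq_Icc (by linarith)]
  simp only [Set.mem_image, Set.mem_Icc, Prod.mk.injEq]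
  constructor
  · rintro ⟨y, h, rfl, rfl⟩
    exact ⟨rfl, h⟩
  · rintro ⟨rfl, h⟩
    exact ⟨y, h, rfl, rfl⟩

lemma Stitch.mem_seg_horiz {i j : ℤ} {x : ℝ × ℝ} :
    x ∈ (Stitch.horiz i j).seg ↔ x.2 = j ∧ (i : ℝ) ≤ x.1 ∧ x.1 ≤ i + 1 := by
  obtain ⟨x, y⟩ := x
  rw [Stitch.seg, ← Prod.image_mk_segment_left, segment_eq_Icc (by linarith)]
  simp only [Set.mem_image, Set.mem_Icc, Prod.mk.injEq]
  constructor
  · rintro ⟨y, h, rfl, rfl⟩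
    exact ⟨rfl, h⟩
  · rintro ⟨rfl, h⟩
    exact ⟨x, h, rfl, rfl⟩

lemma Stitch.isClosed_seg (s : Stitch) : IsClosed s.seg := by
  cases s <;> rw [seg, ← convexHull_pair (𝕜 := ℝ)] <;>
    exact ((Set.toFinite _).isCompact_convexHull ℝ).isClosed

lemma Stitch.midpoint_mem_seg (s : Stitch) : s.midpoint ∈ s.seg := by
  cases s
  · rw [mem_seg_vert, midpoint]; norm_num
  · rw [mem_seg_horiz, midpoint]; norm_num

lemma mem_curveOf {S : Finset Stitch} {x : ℝ × ℝ} :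
    x ∈ curveOf (S : Set Stitch) ↔ ∃ s ∈ S, x ∈ s.seg := by
  simp [curveOf]

lemma isClosed_curveOf (S : Finset Stitch) : IsClosed (curveOf (S : Set Stitch)) :=
  S.finite_toSet.isClosed_biUnion fun s _ => s.isClosed_seg

lemma cast_add_one_le_of_lt {m n : ℤ} (h : m < n) : (m : ℝ) + 1 ≤ n := by exact_mod_cast h

lemma one_le_abs_of_ne {m n : ℤ} (h : m ≠ n) : 1 ≤ |(m : ℝ) - n| := by
  have := Int.one_le_abs (sub_ne_zero.2 h)
  exact_mod_cast this

/-- A stitch stays at distance one from the vertices that are not its endpoints. -/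
lemma Stitch.one_le_of_notMem_ends {s : Stitch} {i j : ℤ} (h : (i, j) ∉ s.ends) {x : ℝ × ℝ}
    (hx : x ∈ s.seg) : 1 ≤ max |x.1 - i| |x.2 - j| := by
  cases s with
  | vert k l =>
    rw [mem_seg_vert] at hx
    simp only [ends, Finset.mem_insert, Finset.mem_singleton, Prod.mk.injEq, not_or, not_and] at h
    by_cases hik : i = k
    · have h1 := h.1 hik
      have h2 := h.2 hik
      refine le_max_of_le_right ?_
      rcases lt_or_gt_of_ne h1 with h3 | h3
      · have := cast_add_one_le_of_lt h3
        rw [le_abs]; left; linarith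
      · have := cast_add_one_le_of_lt (show l + 1 < j by omega)
        push_cast at this
        rw [le_abs]; right; linarith
    · rw [hx.1]
      exact le_max_of_le_left (one_le_abs_of_ne (Ne.symm hik))
  | horiz k l =>
    rw [mem_seg_horiz] at hx
    simp only [ends, Finset.mem_insert, Finset.mem_singleton, Prod.mk.injEq, not_or, not_and'] at h
    by_cases hjl : j = l
    · have h1 := h.1 hjl
      have h2 := h.2 hjl
      refine le_max_of_le_left ?_
      rcases lt_or_gt_of_ne h1 with h3 | h3
      · have := cast_add_one_le_of_lt h3
        rw [le_abs]; left; linarith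
      · have := cast_add_one_le_of_lt (show k + 1 < i by omega)
        push_cast at this
        rw [le_abs]; right; linarith
    · rw [hx.1]
      exact le_max_of_le_right (one_le_abs_of_ne (Ne.symm hjl))

lemma Stitch.eq_midpoint {s : Stitch} {i j : ℤ} (h : (i, j) ∈ s.ends) {x : ℝ × ℝ}
    (hx : x ∈ s.seg) (hd : max |x.1 - i| |x.2 - j| = 1 / 2) : x = s.midpoint := by
  obtain ⟨x, y⟩ := x
  cases s with
  | vert k l =>
    rw [mem_seg_vert] at hx
    simp only [ends, Finset.mem_insert, Finset.mem_singleton, Prod.mk.injEq] at h hx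
    obtain ⟨rfl, hx⟩ := hx
    rcases h with ⟨rfl, rfl⟩ | ⟨rfl, rfl⟩ <;> simp only [midpoint, Prod.mk.injEq, true_and] <;>
      push_cast at * <;> grind
  | horiz k l =>
    rw [mem_seg_horiz] at hx
    simp only [ends, Finset.mem_insert, Finset.mem_singleton, Prod.mk.injEq] at h hx
    obtain ⟨rfl, hx⟩ := hx
    rcases h with ⟨rfl, rfl⟩ | ⟨rfl, rfl⟩ <;> simp only [midpoint, Prod.mk.injEq, and_true] <;>
      push_cast at * <;> grind

/-- Each stitch contains a point at distance `t` from a given endpoint. -/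
lemma Stitch.exists_dist_eq {s : Stitch} {i j : ℤ} (h : (i, j) ∈ s.ends) {t : ℝ} (ht : 0 ≤ t)
    (ht' : t ≤ 1) : ∃ x ∈ s.seg, max |x.1 - i| |x.2 - j| = t := by
  cases s with
  | vert k l =>
    simp only [ends, Finset.mem_insert, Finset.mem_singleton, Prod.mk.injEq] at h
    rcases h with ⟨rfl, rfl⟩ | ⟨rfl, rfl⟩
    · exact ⟨(i, j + t), by rw [mem_seg_vert]; simp [ht, ht'], by simp [abs_of_nonneg ht, ht]⟩
    · refine ⟨(i, l + 1 - t), by rw [mem_seg_vert]; simp [ht]; linarith, ?_⟩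
      simp [abs_of_nonneg ht, ht]
  | horiz k l =>
    simp only [ends, Finset.mem_insert, Finset.mem_singleton, Prod.mk.injEq] at h
    rcases h with ⟨rfl, rfl⟩ | ⟨rfl, rfl⟩
    · exact ⟨(i + t, j), by rw [mem_seg_horiz]; simp [ht, ht'], by simp [abs_of_nonneg ht, ht]⟩
    · refine ⟨(k + 1 - t, j), by rw [mem_seg_horiz]; simp [ht]; linarith, ?_⟩
      simp [abs_of_nonneg ht, ht]

/-- Two stitches that meet have a common endpoint. -/
lemma Stitch.exists_common_end {s t : Stitch} {x : ℝ × ℝ} (hs : x ∈ s.seg) (ht : x ∈ t.seg) :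
    ∃ v ∈ s.ends, v ∈ t.ends := by
  have key : ∀ {i j k : ℤ}, (i : ℝ) ≤ j → (j : ℝ) ≤ k + 1 → i ≤ j ∧ j ≤ k + 1 := fun h1 h2 =>
    ⟨by exact_mod_cast h1, by exact_mod_cast h2⟩
  have key' : ∀ {i j : ℤ} {y : ℝ}, (i : ℝ) ≤ y → y ≤ j + 1 → i ≤ j + 1 := fun h1 h2 => by
    exact_mod_cast h1.trans h2
  have cross : ∀ {i j k l : ℤ}, x ∈ (vert i j).seg → x ∈ (horiz k l).seg →
      ∃ v ∈ (vert i j).ends, v ∈ (horiz k l).ends := by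
    intro i j k l hs ht
    rw [mem_seg_vert] at hs
    rw [mem_seg_horiz] at ht
    rw [ht.1] at hs
    rw [hs.1] at ht
    have h1 := key hs.2.1 hs.2.2
    have h2 := key ht.2.1 ht.2.2
    refine ⟨(i, l), ?_, ?_⟩ <;> simp [ends] <;> omega
  cases s with
  | vert i j =>
    cases t with
    | vert k l =>
      rw [mem_seg_vert] at hs ht
      have h0 : i = k := by exact_mod_cast hs.1.symm.trans ht.1
      have h1 := key' hs.2.1 ht.2.2
      have h2 := key' ht.2.1 hs.2.2
      refine ⟨(i, max j l), ?_, ?_⟩ <;> simp [ends] <;> omega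
    | horiz k l => exact cross hs ht
  | horiz i j =>
    cases t with
    | vert k l =>
      obtain ⟨v, h1, h2⟩ := cross ht hs
      exact ⟨v, h2, h1⟩
    | horiz k l =>
      rw [mem_seg_horiz] at hs ht
      have h0 : j = l := by exact_mod_cast hs.1.symm.trans ht.1
      have h1 := key' hs.2.1 ht.2.2
      have h2 := key' ht.2.1 hs.2.2
      refine ⟨(max i k, j), ?_, ?_⟩ <;> simp [ends] <;> omega

variable {S : Finset Stitch}

/-- A simple closed curve has no loose ends. -/
lemma IsCircle.exists_other_stitch (hC : IsCircle (curveOf (S : Set Stitch))) {s : Stitch}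
    (hs : s ∈ S) {i j : ℤ} (h : (i, j) ∈ s.ends) : ∃ t ∈ S, t ≠ s ∧ (i, j) ∈ t.ends := by
  by_contra! hc
  have hpre := hC.isPreconnected_diff_singleton (mem_curveOf.2 ⟨s, hs, s.midpoint_mem_seg⟩)
  have hcont : Continuous fun x : ℝ × ℝ => max |x.1 - i| |x.2 - j| := by fun_prop
  have hmid : max |s.midpoint.1 - i| |s.midpoint.2 - j| = 1 / 2 := by
    obtain ⟨x, hx, hxd⟩ := Stitch.exists_dist_eq h (t := 1 / 2) (by norm_num) (by norm_num)
    rwa [← Stitch.eq_midpoint h hx hxd]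
  have hex : ∀ t : ℝ, 0 ≤ t → t ≤ 1 → t ≠ 1 / 2 →
      ∃ x ∈ curveOf (S : Set Stitch) \ {s.midpoint}, max |x.1 - i| |x.2 - j| = t := by
    intro t h0 h1 h2
    obtain ⟨x, hx, hxd⟩ := Stitch.exists_dist_eq h h0 h1
    refine ⟨x, ⟨mem_curveOf.2 ⟨s, hs, hx⟩, ?_⟩, hxd⟩
    rintro rfl
    exact h2 (hxd.symm.trans hmid)
  obtain ⟨x, hx, hxd⟩ := hex 0 le_rfl (by norm_num) (by norm_num)
  obtain ⟨y, hy, hyd⟩ := hex 1 (by norm_num) le_rfl (by norm_num)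
  have hcover : curveOf (S : Set Stitch) \ {s.midpoint} ⊆
      {x | max |x.1 - i| |x.2 - j| < 1 / 2} ∪ {x | 1 / 2 < max |x.1 - i| |x.2 - j|} := by
    intro z hz
    refine lt_or_gt_of_ne (a := max |z.1 - (i : ℝ)| |z.2 - j|) fun he => ?_
    obtain ⟨t, ht, hzt⟩ := mem_curveOf.1 hz.1
    by_cases hts : t = s
    · subst hts
      exact hz.2 (Stitch.eq_midpoint h hzt he)
    · have := Stitch.one_le_of_notMem_ends (hc t ht hts) hzt
      rw [he] at this
      norm_num at this
  obtain ⟨z, -, hz1, hz2⟩ := hpre {x | max |x.1 - i| |x.2 - j| < 1 / 2}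
    {x | 1 / 2 < max |x.1 - i| |x.2 - j|} (isOpen_lt hcont continuous_const)
    (isOpen_lt continuous_const hcont) hcover
    ⟨x, hx, show max |x.1 - i| |x.2 - j| < 1 / 2 by rw [hxd]; norm_num⟩
    ⟨y, hy, show 1 / 2 < max |y.1 - i| |y.2 - j| by rw [hyd]; norm_num⟩
  exact lt_asymm (show max |z.1 - i| |z.2 - j| < 1 / 2 from hz1) hz2

lemma IsCircle.degree_iff {ε η : ℤ → ZMod 2} (hC : IsCircle (curveOf (S : Set Stitch)))
    (hS : ∀ s ∈ S, s.InPattern ε η) (i j : ℤ) :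
    (Stitch.horiz i j ∈ S ∨ Stitch.horiz (i - 1) j ∈ S) ↔
      (Stitch.vert i j ∈ S ∨ Stitch.vert i (j - 1) ∈ S) := by
  have hne : ∀ x y : ZMod 2, x = y → x - 1 ≠ y := by decide
  have hH : Stitch.horiz i j ∈ S → Stitch.horiz (i - 1) j ∉ S := fun h1 h2 =>
    hne _ _ (hS _ h1) (by simpa [Stitch.InPattern] using hS _ h2)
  have hV : Stitch.vert i j ∈ S → Stitch.vert i (j - 1) ∉ S := fun h1 h2 =>
    hne _ _ (hS _ h1) (by simpa [Stitch.InPattern] using hS _ h2)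
  have key : ∀ s ∈ S, (i, j) ∈ s.ends → ∃ t ∈ S, t ≠ s ∧ (t = .horiz i j ∨ t = .horiz (i - 1) j ∨
      t = .vert i j ∨ t = .vert i (j - 1)) := by
    intro s hs h
    obtain ⟨t, ht, hts, hm⟩ := hC.exists_other_stitch hs h
    refine ⟨t, ht, hts, ?_⟩
    cases t <;> simp [Stitch.ends] at hm ⊢ <;> omega
  constructor
  · rintro (h | h)
    · obtain ⟨t, ht, hts, rfl | rfl | rfl | rfl⟩ := key _ h (by simp [Stitch.ends]) <;> tauto
    · obtain ⟨t, ht, hts, rfl | rfl | rfl | rfl⟩ := key _ h (by simp [Stitch.ends]) <;> tauto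
  · rintro (h | h)
    · obtain ⟨t, ht, hts, rfl | rfl | rfl | rfl⟩ := key _ h (by simp [Stitch.ends]) <;> tauto
    · obtain ⟨t, ht, hts, rfl | rfl | rfl | rfl⟩ := key _ h (by simp [Stitch.ends]) <;> tauto

/-- The stitches of a simple closed curve form a connected graph. -/
lemma IsCircle.connected (hC : IsCircle (curveOf (S : Set Stitch))) (Q : Set (ℤ × ℤ))
    (hH : ∀ i j, Stitch.horiz i j ∈ S → ((i, j) ∈ Q ↔ (i + 1, j) ∈ Q))
    (hV : ∀ i j, Stitch.vert i j ∈ S → ((i, j) ∈ Q ↔ (i, j + 1) ∈ Q)) (i j i' j' : ℤ)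
    (hs : Stitch.horiz i j ∈ S) (hQ : (i, j) ∈ Q) (hs' : Stitch.horiz i' j' ∈ S) :
    (i', j') ∈ Q := by
  classical
  by_contra hQ'
  have hends : ∀ s ∈ S, ∀ u ∈ s.ends, ∀ v ∈ s.ends, u ∈ Q → v ∈ Q := by
    intro s hs u hu v hv
    cases s with
    | vert k l =>
      have := hV k l hs
      simp only [Stitch.ends, Finset.mem_insert, Finset.mem_singleton] at hu hv
      rcases hu with rfl | rfl <;> rcases hv with rfl | rfl <;> tauto
    | horiz k l =>
      have := hH k l hs
      simp only [Stitch.ends, Finset.mem_insert, Finset.mem_singleton] at hu hv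
      rcases hu with rfl | rfl <;> rcases hv with rfl | rfl <;> tauto
  set A := S.filter fun s => ∀ v ∈ s.ends, v ∈ Q with hA
  set B := S.filter fun s => ∀ v ∈ s.ends, v ∉ Q with hB
  have hsA : Stitch.horiz i j ∈ A := Finset.mem_filter.2 ⟨hs, fun v hv =>
    hends _ hs _ (by simp [Stitch.ends]) v hv hQ⟩
  have hsB : Stitch.horiz i' j' ∈ B := Finset.mem_filter.2 ⟨hs', fun v hv h =>
    hQ' (hends _ hs' v hv _ (by simp [Stitch.ends]) h)⟩
  have hcover : curveOf (S : Set Stitch) ⊆ curveOf (A : Set Stitch) ∪ curveOf (B : Set Stitch) := by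
    intro x hx
    obtain ⟨s, hs, hxs⟩ := mem_curveOf.1 hx
    by_cases h : ∀ v ∈ s.ends, v ∈ Q
    · exact Or.inl (mem_curveOf.2 ⟨s, Finset.mem_filter.2 ⟨hs, h⟩, hxs⟩)
    · push Not at h
      obtain ⟨v, hv, hvQ⟩ := h
      exact Or.inr (mem_curveOf.2 ⟨s, Finset.mem_filter.2 ⟨hs, fun u hu huQ =>
        hvQ (hends s hs u hu v hv huQ)⟩, hxs⟩)
  obtain ⟨x, -, hxA, hxB⟩ := isPreconnected_closed_iff.1 hC.isPreconnected _ _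
    (isClosed_curveOf A) (isClosed_curveOf B) hcover
    ⟨_, mem_curveOf.2 ⟨_, hs, Stitch.midpoint_mem_seg _⟩,
      mem_curveOf.2 ⟨_, hsA, Stitch.midpoint_mem_seg _⟩⟩
    ⟨_, mem_curveOf.2 ⟨_, hs', Stitch.midpoint_mem_seg _⟩,
      mem_curveOf.2 ⟨_, hsB, Stitch.midpoint_mem_seg _⟩⟩
  obtain ⟨s, hsA, hxs⟩ := mem_curveOf.1 hxA
  obtain ⟨t, htB, hxt⟩ := mem_curveOf.1 hxB
  obtain ⟨v, hvs, hvt⟩ := Stitch.exists_common_end hxs hxt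
  exact (Finset.mem_filter.1 htB).2 v hvt ((Finset.mem_filter.1 hsA).2 v hvs)

end Curve

section Interior

variable {S : Finset Stitch}

/-- The centre of a cell. -/
noncomputable def cellCenter (i j : ℤ) : ℝ × ℝ := (i + 1 / 2, j + 1 / 2)

lemma cellCenter_mem_cell (i j : ℤ) : cellCenter i j ∈ cell i j := by
  constructor <;> constructor <;> simp only [cellCenter] <;> linarith

lemma not_int_between {k m : ℤ} (h : (k : ℝ) < m) (h' : (m : ℝ) < k + 1) : False := by
  have h1 : k < m := by exact_mod_cast h
  have h2 : m < k + 1 := by exact_mod_cast h'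
  omega

lemma cell_subset_compl (i j : ℤ) : cell i j ⊆ (curveOf (S : Set Stitch))ᶜ := by
  rintro x ⟨⟨h1, h2⟩, h3, h4⟩ hx
  obtain ⟨s, -, hs⟩ := mem_curveOf.1 hx
  cases s with
  | vert k l =>
    rw [Stitch.mem_seg_vert] at hs
    rw [hs.1] at h1 h2
    exact not_int_between h1 h2
  | horiz k l =>
    rw [Stitch.mem_seg_horiz] at hs
    rw [hs.1] at h3 h4
    exact not_int_between h3 h4

lemma isPreconnected_cell (i j : ℤ) : IsPreconnected (cell i j) :=
  isPreconnected_Ioo.prod isPreconnected_Ioo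

lemma floor_of_mem_cell {i j : ℤ} {x : ℝ × ℝ} (hx : x ∈ cell i j) : ⌊x.1⌋ = i ∧ ⌊x.2⌋ = j :=
  ⟨Int.floor_eq_iff.2 ⟨hx.1.1.le, hx.1.2⟩, Int.floor_eq_iff.2 ⟨hx.2.1.le, hx.2.2⟩⟩

/-- Neighbouring cells not separated by a stitch lie in the same component of the complement. -/
lemma constantOff_component (S : Finset Stitch) : ConstantOff S fun i j =>
    connectedComponentIn (curveOf (S : Set Stitch))ᶜ (cellCenter i j) := by
  refine ⟨fun i j hs => ?_, fun i j hs => ?_⟩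
  · have hpre : IsPreconnected (Set.Ioo (i : ℝ) (i + 1) ×ˢ Set.Ioo (j - 1 : ℝ) (j + 1)) :=
      isPreconnected_Ioo.prod isPreconnected_Ioo
    refine connectedComponentIn_eq (hpre.subset_connectedComponentIn ?_ ?_ ?_)
    · simp only [cellCenter]; push_cast
      refine ⟨⟨?_, ?_⟩, ?_, ?_⟩ <;> simp only <;> linarith
    · rintro x ⟨⟨h1, h2⟩, h3, h4⟩ hx
      obtain ⟨s, hsS, hxs⟩ := mem_curveOf.1 hx
      cases s with
      | vert k l =>
        rw [Stitch.mem_seg_vert] at hxs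
        rw [hxs.1] at h1 h2
        exact not_int_between h1 h2
      | horiz k l =>
        rw [Stitch.mem_seg_horiz] at hxs
        obtain ⟨e, h5, h6⟩ := hxs
        rw [e] at h3 h4
        have hl : l = j := by
          have h7 : j - 1 < l := by exact_mod_cast h3
          have h8 : l < j + 1 := by exact_mod_cast h4
          omega
        have hk : k = i := by
          have h7 : i < k + 1 := by exact_mod_cast h1.trans_le h6
          have h8 : k < i + 1 := by exact_mod_cast h5.trans_lt h2
          omega
        exact hs (hk ▸ hl ▸ hsS)
    · simp only [cellCenter]
      refine ⟨⟨?_, ?_⟩, ?_, ?_⟩ <;> simp only <;> linarith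
  · have hpre : IsPreconnected (Set.Ioo (i - 1 : ℝ) (i + 1) ×ˢ Set.Ioo (j : ℝ) (j + 1)) :=
      isPreconnected_Ioo.prod isPreconnected_Ioo
    refine connectedComponentIn_eq (hpre.subset_connectedComponentIn ?_ ?_ ?_)
    · simp only [cellCenter]; push_cast
      refine ⟨⟨?_, ?_⟩, ?_, ?_⟩ <;> simp only <;> linarith
    · rintro x ⟨⟨h1, h2⟩, h3, h4⟩ hx
      obtain ⟨s, hsS, hxs⟩ := mem_curveOf.1 hx
      cases s with
      | horiz k l =>
        rw [Stitch.mem_seg_horiz] at hxs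
        rw [hxs.1] at h3 h4
        exact not_int_between h3 h4
      | vert k l =>
        rw [Stitch.mem_seg_vert] at hxs
        obtain ⟨e, h5, h6⟩ := hxs
        rw [e] at h1 h2
        have hk : k = i := by
          have h7 : i - 1 < k := by exact_mod_cast h1
          have h8 : k < i + 1 := by exact_mod_cast h2
          omega
        have hl : l = j := by
          have h7 : j < l + 1 := by exact_mod_cast h3.trans_le h6
          have h8 : l < j + 1 := by exact_mod_cast h5.trans_lt h4
          omega
        exact hs (hk ▸ hl ▸ hsS)
    · simp only [cellCenter]
      refine ⟨⟨?_, ?_⟩, ?_, ?_⟩ <;> simp only <;> linarith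

/-- A point off the curve is surrounded by cells on which `g` agrees. -/
lemma ConstantOff.eventually_eq {γ : Type*} {g : ℤ → ℤ → γ} (hg : ConstantOff S g) {x : ℝ × ℝ}
    (hx : x ∉ curveOf (S : Set Stitch)) : ∀ᶠ y in nhds x, g ⌊x.1⌋ ⌊x.2⌋ = g ⌊y.1⌋ ⌊y.2⌋ := by
  have hnhds : ∀ t : ℝ, ∀ᶠ u in nhds t, ⌊u⌋ = ⌊t⌋ ∨ (t = ⌊t⌋ ∧ ⌊u⌋ = ⌊t⌋ - 1) := by
    intro t
    by_cases ht : t = ⌊t⌋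
    · filter_upwards [Ioo_mem_nhds (show t - 1 < t by linarith) (show t < t + 1 by linarith)]
        with u hu
      rcases le_or_gt t u with h | h
      · left
        rw [Int.floor_eq_iff, ← ht]
        exact ⟨h, hu.2⟩
      · right
        refine ⟨ht, ?_⟩
        rw [Int.floor_eq_iff]
        push_cast
        rw [← ht]
        exact ⟨hu.1.le, by linarith⟩
    · have hlt : (⌊t⌋ : ℝ) < t := lt_of_le_of_ne (Int.floor_le t) (Ne.symm ht)
      filter_upwards [Ioo_mem_nhds hlt (Int.lt_floor_add_one t)] with u hu
      exact Or.inl (Int.floor_eq_iff.2 ⟨hu.1.le, hu.2⟩)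
  have hmem : ∀ s, x ∈ s.seg → s ∉ S := fun s hs hsS => hx (mem_curveOf.2 ⟨s, hsS, hs⟩)
  have f1 := Int.floor_le x.1
  have f2 := Int.lt_floor_add_one x.1
  have f3 := Int.floor_le x.2
  have f4 := Int.lt_floor_add_one x.2
  have hV : x.1 = ⌊x.1⌋ → Stitch.vert ⌊x.1⌋ ⌊x.2⌋ ∉ S := fun h =>
    hmem _ (Stitch.mem_seg_vert.2 ⟨h, f3, f4.le⟩)
  have hH : x.2 = ⌊x.2⌋ → Stitch.horiz ⌊x.1⌋ ⌊x.2⌋ ∉ S := fun h =>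
    hmem _ (Stitch.mem_seg_horiz.2 ⟨h, f1, f2.le⟩)
  have hH' : x.1 = ⌊x.1⌋ → x.2 = ⌊x.2⌋ → Stitch.horiz (⌊x.1⌋ - 1) ⌊x.2⌋ ∉ S := fun h h' =>
    hmem _ (Stitch.mem_seg_horiz.2 ⟨h', by push_cast; linarith, by push_cast; linarith⟩)
  filter_upwards [continuous_fst.continuousAt.eventually (hnhds x.1),
    continuous_snd.continuousAt.eventually (hnhds x.2)] with y h1 h2
  rcases h1 with h1 | ⟨e1, h1⟩ <;> rcases h2 with h2 | ⟨e2, h2⟩ <;> rw [h1, h2]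
  · rw [hg.horiz _ _ (hH e2)]
  · rw [hg.vert _ _ (hV e1)]
  · rw [hg.horiz _ _ (hH' e1 e2), hg.vert _ _ (hV e1)]

/-- The interior of an oriented loop consists, up to points of the grid, of the cells of
parity one. -/
lemma IsOrientedLoop.mem_intOf_iff {κ : ℤ} {a b : ℤ → ℤ} (h : IsOrientedLoop κ a b S)
    {v₀ : ℤ × ℤ} (hv₀ : IsLowest S v₀) (hp : Even (v₀.1 + v₀.2 + κ)) {i j : ℤ} {x : ℝ × ℝ}
    (hx : x ∈ cell i j) : x ∈ intOf (curveOf (S : Set Stitch)) ↔ cellParity S i j = 1 := by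
  set C := curveOf (S : Set Stitch) with hC
  have hxC : x ∈ Cᶜ := cell_subset_compl i j hx
  have hcomp : ∀ i j, ∀ y ∈ cell i j, y ∈ connectedComponentIn Cᶜ (cellCenter i j) := fun i j y hy =>
    (isPreconnected_cell i j).subset_connectedComponentIn (cellCenter_mem_cell i j)
      (cell_subset_compl i j) hy
  constructor
  · rintro ⟨-, hb⟩
    by_contra hne
    have hzero : cellParity S i j = 0 := by
      generalize cellParity S i j = z at hne
      revert z; decide
    obtain ⟨i', j', hk⟩ := h.exists_eq_of_cellParity_eq_zero hv₀ hp (constantOff_component S) hzero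
    rw [← connectedComponentIn_eq (hcomp i j x hx)] at hb
    obtain ⟨r, hr⟩ := hb.exists_norm_le
    obtain ⟨n, hn⟩ := exists_nat_gt (r + 1)
    have hmem : cellCenter i' (min j' (-n)) ∈ connectedComponentIn Cᶜ (cellCenter i j) := by
      rw [← hk _ (min_le_left _ _)]
      exact hcomp _ _ _ (cellCenter_mem_cell _ _)
    have h1 := (norm_snd_le _).trans (hr _ hmem)
    have h2 : ((min j' (-n) : ℤ) : ℝ) ≤ -n := by
      have : min j' (-(n : ℤ)) ≤ -n := min_le_right _ _
      exact_mod_cast this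
    rw [Real.norm_eq_abs, abs_le] at h1
    simp only [cellCenter] at h1
    linarith
  · intro hone
    refine ⟨hxC, ?_⟩
    obtain ⟨M, hM⟩ := h.cellParity_bound
    refine (Metric.isBounded_Icc ((-M : ℝ), (-M : ℝ)) ((M : ℝ) + 1, (M : ℝ) + 1)).subset ?_
    intro y hy
    have hpar : cellParity S ⌊x.1⌋ ⌊x.2⌋ = cellParity S ⌊y.1⌋ ⌊y.2⌋ := by
      refine (isPreconnected_connectedComponentIn (F := Cᶜ) (x := x)).induction₂
        (fun y z => cellParity S ⌊y.1⌋ ⌊y.2⌋ = cellParity S ⌊z.1⌋ ⌊z.2⌋) ?_ ?_ ?_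
        (mem_connectedComponentIn hxC) hy
      · intro z hz
        exact nhdsWithin_le_nhds
          (h.constantOff_cellParity.eventually_eq (connectedComponentIn_subset _ _ hz))
      · intro _ _ _ _ _ _ h1 h2; exact h1.trans h2
      · intro _ _ _ _ h1; exact h1.symm
    rw [(floor_of_mem_cell hx).1, (floor_of_mem_cell hx).2, hone] at hpar
    obtain ⟨h1, h2, h3, h4⟩ := hM ⌊y.1⌋ ⌊y.2⌋ (by rw [← hpar]; decide)
    have cast_le : ∀ {t : ℝ}, -M ≤ ⌊t⌋ → ⌊t⌋ ≤ M → -(M : ℝ) ≤ t ∧ t ≤ M + 1 := by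
      intro t h1 h2
      rw [Int.le_floor] at h1
      push_cast at h1
      refine ⟨h1, (Int.lt_floor_add_one t).le.trans ?_⟩
      have : (⌊t⌋ : ℝ) ≤ M := by exact_mod_cast h2
      linarith
    have b1 := cast_le h1 h2
    have b2 := cast_le h3 h4
    exact ⟨⟨b1.1, b2.1⟩, b1.2, b2.2⟩

open MeasureTheory in
lemma ae_mem_cell : ∀ᵐ x : ℝ × ℝ, x ∈ cell ⌊x.1⌋ ⌊x.2⌋ := by
  have hR : ∀ᵐ t : ℝ, t ∉ Set.range ((↑) : ℤ → ℝ) := (Set.countable_range _).ae_notMem _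
  have h1 : ∀ᵐ x : ℝ × ℝ, x.1 ∉ Set.range ((↑) : ℤ → ℝ) :=
    Measure.quasiMeasurePreserving_fst.ae hR
  have h2 : ∀ᵐ x : ℝ × ℝ, x.2 ∉ Set.range ((↑) : ℤ → ℝ) :=
    Measure.quasiMeasurePreserving_snd.ae hR
  filter_upwards [h1, h2] with x h1 h2
  exact ⟨⟨lt_of_le_of_ne (Int.floor_le _) fun h => h1 ⟨_, h⟩, Int.lt_floor_add_one _⟩,
    lt_of_le_of_ne (Int.floor_le _) fun h => h2 ⟨_, h⟩, Int.lt_floor_add_one _⟩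

open MeasureTheory in
lemma volume_eq_card {A : Set (ℝ × ℝ)} {F : Finset (ℤ × ℤ)}
    (hA : ∀ i j, ∀ x ∈ cell i j, x ∈ A ↔ (i, j) ∈ F) : volume A = F.card := by
  have hae : A =ᵐ[volume] ⋃ c ∈ F, cell c.1 c.2 := by
    filter_upwards [ae_mem_cell] with x hx
    refine propext ((hA _ _ x hx).trans ?_)
    constructor
    · exact fun h => Set.mem_biUnion h hx
    · intro h
      obtain ⟨c, hc, hxc⟩ := Set.mem_iUnion₂.1 h
      rwa [(floor_of_mem_cell hxc).1, (floor_of_mem_cell hxc).2]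
  rw [measure_congr hae, measure_biUnion_finset]
  · have : ∀ c ∈ F, volume (cell c.1 c.2) = 1 := by
      intro c _
      rw [cell, Measure.volume_eq_prod, Measure.prod_prod]
      simp
    rw [Finset.sum_congr rfl this]
    simp
  · intro c _ d _ hcd
    refine Set.disjoint_left.2 fun x hc hd => hcd ?_
    have h1 := floor_of_mem_cell hc
    have h2 := floor_of_mem_cell hd
    exact Prod.ext (h1.1.symm.trans h2.1) (h1.2.symm.trans h2.2)
  · exact fun c _ => measurableSet_Ioo.prod measurableSet_Ioo

end Interior

/-- Every hitomezashi loop has area (the area of the bounded component of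
its complement) congruent to `1` modulo `4`. -/
theorem hitomezashi_loop_area_mod_four (ε η : ℤ → ZMod 2) (L : HLoop ε η) :
    ∃ k : ℕ, MeasureTheory.volume (intOf (curveOf ↑L.stitches)) = 4 * (k : ENNReal) + 1 := by
  obtain ⟨S, hpat, hcirc⟩ := L
  have hne : S.Nonempty := by
    obtain ⟨x, hx⟩ := hcirc.nonempty
    obtain ⟨s, hs, -⟩ := mem_curveOf.1 hx
    exact ⟨s, hs⟩
  obtain ⟨v₀, hv₀⟩ := exists_isLowest hne
  have h := IsOrientedLoop.of_inPattern hpat (hcirc.degree_iff hpat) hcirc.connected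
    (v₀.1 + v₀.2)
  have hp : Even (v₀.1 + v₀.2 + (v₀.1 + v₀.2)) := ⟨v₀.1 + v₀.2, rfl⟩
  obtain ⟨M, hM⟩ := h.cellParity_bound
  set F : Finset (ℤ × ℤ) := (Finset.Icc (-M) M ×ˢ Finset.Icc (-M) M).filter
    fun c => cellParity S c.1 c.2 = 1 with hFdef
  have hF : ∀ i j, (i, j) ∈ F ↔ cellParity S i j = 1 := by
    intro i j
    simp only [hFdef, Finset.mem_filter, Finset.mem_product, Finset.mem_Icc, and_iff_right_iff_imp]
    intro hij
    have := hM i j (by rw [hij]; decide)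
    tauto
  refine ⟨F.card / 4, ?_⟩
  have hcard : F.card = 4 * (F.card / 4) + 1 := by
    have := h.card_mod_four hv₀ hp hF
    omega
  rw [volume_eq_card fun i j x hx => (h.mem_intOf_iff hv₀ hp hx).trans (hF i j).symm]
  exact_mod_cast congrArg (Nat.cast (R := ENNReal)) hcard
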